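/- arXiv:1702.00320 — 2 statements merged into one kernel-verified Lean document; each statement's English description precedes it below -/
import Mathlib

section
/- Let A be a finite alphabet with |A| ≥ 2 and fix a sequence S_1, S_2, … of shufflers over A. For each positive integer n set ℓ_n = (log_{|A|} n)/3, t_n = n, ε_n = 2·√((log n · log_{|A|} n)/n), and F_n = F(ε_n, t_n, ℓ_n, n). Then for all sufficiently large n (in particular all n with ε_n ≥ 6/⌊n/ℓ_n⌋), (μ×μ)(F_n) ≥ 1 − 1/n². -/
open Filter Topology

namespace FSI

variable {A B D Q : Type*}

/-- The prefix of length `n` of the infinite word `x`. -/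
def pref (x : ℕ → A) (n : ℕ) : List A := (List.range n).map x

/-- Number of (possibly overlapping) occurrences of `u` in `w`. -/
noncomputable def occ (w u : List A) : ℕ :=
  Nat.card {i : ℕ | i + u.length ≤ w.length ∧ (w.drop i).take u.length = u}

/-- Number of aligned occurrences of `u` in `w`. -/
noncomputable def alocc (w u : List A) : ℕ :=
  Nat.card {i : ℕ | i + u.length ≤ w.length ∧ i % u.length = 0 ∧ (w.drop i).take u.length = u}

/-- `x` is simply normal to word length `ℓ`. -/
def SimplyNormalTo [Fintype A] (x : ℕ → A) (ℓ : ℕ) : Prop :=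
  ∀ u : List A, u.length = ℓ →
    Tendsto (fun n : ℕ => (alocc (pref x (n * ℓ)) u : ℝ) / n) atTop
      (nhds ((Fintype.card A : ℝ)⁻¹ ^ ℓ))

/-- `x` is a normal infinite word. -/
def Normal [Fintype A] (x : ℕ → A) : Prop := ∀ ℓ : ℕ, 1 ≤ ℓ → SimplyNormalTo x ℓ

/-! ### Two-tape automata -/

/-- A `2`-automaton with input alphabets `A`, `B` and state set `Q`;
`none` plays the role of the empty word `ε` in transition labels. -/
structure TwoAut (A B Q : Type*) where
  init : Set Q
  trans : Set (Q × (Option A × Option B) × Q)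

/-- The support of a label. -/
def lsupp (l : Option A × Option B) : Bool × Bool := (l.1.isSome, l.2.isSome)

/-- A `2`-deterministic `2`-automaton. -/
def TwoAut.TwoDet (M : TwoAut A B Q) : Prop :=
  (∃ q₀, M.init = {q₀}) ∧
  ∀ t ∈ M.trans, ∀ t' ∈ M.trans, t.1 = t'.1 →
    lsupp t.2.1 = lsupp t'.2.1 ∧ (t.2.1 = t'.2.1 → t = t')

/-- A `1`-deterministic `2`-automaton. -/
def TwoAut.OneDet (M : TwoAut A B Q) : Prop :=
  (∃ q₀, M.init = {q₀}) ∧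
  ∀ t ∈ M.trans, ∀ t' ∈ M.trans, t.1 = t'.1 →
    t.2.1.1.isSome = t'.2.1.1.isSome ∧ (t.2.1.1 = t'.2.1.1 → t = t')

/-- `2`-completeness. -/
def TwoAut.TwoComplete (M : TwoAut A B Q) : Prop :=
  ∀ (q : Q) (l l' : Option A × Option B),
    (∃ q', (q, l, q') ∈ M.trans) → lsupp l' = lsupp l → ∃ q', (q, l', q') ∈ M.trans

/-- Every transition reads exactly one symbol. -/
def TwoAut.OneSymbol (M : TwoAut A B Q) : Prop :=
  ∀ t ∈ M.trans, lsupp t.2.1 = (true, false) ∨ lsupp t.2.1 = (false, true)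

def TwoAut.Step (M : TwoAut A B Q) (p q : Q) : Prop := ∃ l, (p, l, q) ∈ M.trans

/-- There is a finite run from `p` to `q`. -/
def TwoAut.Reaches (M : TwoAut A B Q) : Q → Q → Prop := Relation.ReflTransGen M.Step

def TwoAut.StronglyConnected (M : TwoAut A B Q) : Prop := ∀ p q, M.Reaches p q

/-- Word read on the first tape by the first `n` transitions of `γ`. -/
def in1 (γ : ℕ → Q × (Option A × Option B) × Q) (n : ℕ) : List A :=
  ((List.range n).map fun i => (γ i).2.1.1).reduceOption

/-- Word read on the second tape by the first `n` transitions of `γ`. -/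
def in2 (γ : ℕ → Q × (Option A × Option B) × Q) (n : ℕ) : List B :=
  ((List.range n).map fun i => (γ i).2.1.2).reduceOption

/-- `γ` is an infinite run of `M` (not necessarily from the initial state) whose
two input labels are the infinite words `x` and `y`. -/
def TwoAut.IsRunOn (M : TwoAut A B Q) (γ : ℕ → Q × (Option A × Option B) × Q)
    (x : ℕ → A) (y : ℕ → B) : Prop :=
  (∀ n, γ n ∈ M.trans) ∧ (∀ n, (γ n).2.2 = (γ (n + 1)).1) ∧
  (∀ n, in1 γ n = pref x (in1 γ n).length) ∧ (∀ n, in2 γ n = pref y (in2 γ n).length) ∧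
  Tendsto (fun n => (in1 γ n).length) atTop atTop ∧
  Tendsto (fun n => (in2 γ n).length) atTop atTop

/-- The pair `(x, y)` is accepted by `M`. -/
def TwoAut.Accepts (M : TwoAut A B Q) (x : ℕ → A) (y : ℕ → B) : Prop :=
  ∃ γ, (γ 0).1 ∈ M.init ∧ M.IsRunOn γ x y

/-- Number of occurrences of the state `q` among the first `n` transitions of `γ`. -/
noncomputable def stateCount (γ : ℕ → Q × (Option A × Option B) × Q) (q : Q) (n : ℕ) : ℕ :=
  Nat.card {i : ℕ | i < n ∧ (γ i).1 = q}

/-- Number of occurrences of the transition `τ` among the first `n` transitions of `γ`. -/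
noncomputable def transCount (γ : ℕ → Q × (Option A × Option B) × Q)
    (τ : Q × (Option A × Option B) × Q) (n : ℕ) : ℕ :=
  Nat.card {i : ℕ | i < n ∧ γ i = τ}

/-! ### Markov chain associated with a one-symbol automaton -/

/-- The `(p,q)` entry of the Markov matrix associated with the transition set `T`. -/
noncomputable def markovOf {S : Type*} [Fintype A] [Fintype B]
    (T : Set (S × (Option A × Option B) × S)) (p q : S) : ℝ :=
  (Nat.card {a : A | (p, (some a, none), q) ∈ T} : ℝ) / (Fintype.card A : ℝ) +
  (Nat.card {b : B | (p, (none, some b), q) ∈ T} : ℝ) / (Fintype.card B : ℝ)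

/-- `π` is a stationary distribution for the transition set `T` restricted to the
finite state set `st`. -/
def IsStationaryOn {S : Type*} [Fintype A] [Fintype B]
    (T : Set (S × (Option A × Option B) × S)) (st : Finset S) (π : S → ℝ) : Prop :=
  (∀ s ∈ st, 0 ≤ π s) ∧ (∑ s ∈ st, π s = 1) ∧
  ∀ q ∈ st, (∑ p ∈ st, π p * markovOf T p q) = π q

/-- `π` is a stationary distribution of the Markov chain associated with `M`. -/
def TwoAut.IsStationary [Fintype A] [Fintype B] [Fintype Q]
    (M : TwoAut A B Q) (π : Q → ℝ) : Prop :=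
  IsStationaryOn M.trans Finset.univ π

/-- The frequency property for the pair `(x, y)`: in every strongly connected
`2`-deterministic `2`-automaton (reading one symbol per transition), every infinite run
on a suffix of `x` and a suffix of `y` visits each state with frequency given by the
stationary distribution, and the automaton is `2`-complete. -/
def FreqProp [Fintype A] [Fintype B] (x : ℕ → A) (y : ℕ → B) : Prop :=
  ∀ (Q' : Type) [Fintype Q'] (M : TwoAut A B Q'), M.TwoDet → M.OneSymbol →
    M.StronglyConnected →
    ∀ (i j : ℕ) (γ : ℕ → Q' × (Option A × Option B) × Q'),
      M.IsRunOn γ (fun n => x (n + i)) (fun n => y (n + j)) →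
      M.TwoComplete ∧
      ∃ π : Q' → ℝ, M.IsStationary π ∧
        ∀ q, Tendsto (fun n : ℕ => (stateCount γ q n : ℝ) / n) atTop (nhds (π q))

/-! ### Conditional compressors (2-deterministic 3-automata) -/

/-- A `3`-automaton with two input tapes (alphabets `A` and `B`) and one
output tape (alphabet `D`), with a single initial state. -/
structure Comp3 (A B D Q : Type*) where
  init : Q
  trans : Set (Q × (Option A × Option B) × List D × Q)

/-- `2`-determinism for `3`-automata. -/
def Comp3.TwoDet (C : Comp3 A B D Q) : Prop :=
  ∀ t ∈ C.trans, ∀ t' ∈ C.trans, t.1 = t'.1 →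
    lsupp t.2.1 = lsupp t'.2.1 ∧ (t.2.1 = t'.2.1 → t = t')

def c3in1 (γ : ℕ → Q × (Option A × Option B) × List D × Q) (n : ℕ) : List A :=
  ((List.range n).map fun i => (γ i).2.1.1).reduceOption

def c3in2 (γ : ℕ → Q × (Option A × Option B) × List D × Q) (n : ℕ) : List B :=
  ((List.range n).map fun i => (γ i).2.1.2).reduceOption

def c3out (γ : ℕ → Q × (Option A × Option B) × List D × Q) (n : ℕ) : List D :=
  ((List.range n).map fun i => (γ i).2.2.1).flatten

/-- `γ` is the accepting run of `C` on the pair `(x, y)`. -/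
def Comp3.IsAccRunOn (C : Comp3 A B D Q) (γ : ℕ → Q × (Option A × Option B) × List D × Q)
    (x : ℕ → A) (y : ℕ → B) : Prop :=
  (γ 0).1 = C.init ∧ (∀ n, γ n ∈ C.trans) ∧ (∀ n, (γ n).2.2.2 = (γ (n + 1)).1) ∧
  (∀ n, c3in1 γ n = pref x (c3in1 γ n).length) ∧
  (∀ n, c3in2 γ n = pref y (c3in2 γ n).length) ∧
  Tendsto (fun n => (c3in1 γ n).length) atTop atTop ∧
  Tendsto (fun n => (c3in2 γ n).length) atTop atTop ∧
  Tendsto (fun n => (c3out γ n).length) atTop atTop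

/-- For every fixed second input `y`, the input-output map `x ↦ C(x,y)` is one-to-one. -/
def Comp3.OneToOne (C : Comp3 A B D Q) : Prop :=
  ∀ (x x' : ℕ → A) (y : ℕ → B) γ γ', C.IsAccRunOn γ x y → C.IsAccRunOn γ' x' y →
    (∀ n, ∃ m, c3out γ n <+: c3out γ' m) → (∀ n, ∃ m, c3out γ' n <+: c3out γ m) →
    x = x'

/-- The conditional compression ratio `ρ(x/y)`: the infimum, over all conditional
compressors, of the compression ratio of `x` given the oracle `y`. -/
noncomputable def condRho [Fintype A] [Fintype B] (x : ℕ → A) (y : ℕ → B) : ℝ :=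
  sInf {r : ℝ | ∃ (m d : ℕ), 2 ≤ d ∧ ∃ C : Comp3 A B (Fin d) (Fin m),
    C.TwoDet ∧ C.OneToOne ∧ ∃ γ, C.IsAccRunOn γ x y ∧
      r = Filter.liminf (fun n : ℕ =>
        (((c3out γ n).length : ℝ) * Real.log d) /
        (((c3in1 γ n).length : ℝ) * Real.log (Fintype.card A))) atTop}

/-! ### Compressors (one-to-one 1-deterministic 2-automata) -/

/-- A `2`-automaton with one input tape (alphabet `A`) and one output tape
(alphabet `D`), with a single initial state. -/
structure Comp2 (A D Q : Type*) where
  init : Q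
  trans : Set (Q × Option A × List D × Q)

def Comp2.OneDet (C : Comp2 A D Q) : Prop :=
  ∀ t ∈ C.trans, ∀ t' ∈ C.trans, t.1 = t'.1 →
    t.2.1.isSome = t'.2.1.isSome ∧ (t.2.1 = t'.2.1 → t = t')

def c2in (γ : ℕ → Q × Option A × List D × Q) (n : ℕ) : List A :=
  ((List.range n).map fun i => (γ i).2.1).reduceOption

def c2out (γ : ℕ → Q × Option A × List D × Q) (n : ℕ) : List D :=
  ((List.range n).map fun i => (γ i).2.2.1).flatten

def Comp2.IsAccRunOn (C : Comp2 A D Q) (γ : ℕ → Q × Option A × List D × Q)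
    (x : ℕ → A) : Prop :=
  (γ 0).1 = C.init ∧ (∀ n, γ n ∈ C.trans) ∧ (∀ n, (γ n).2.2.2 = (γ (n + 1)).1) ∧
  (∀ n, c2in γ n = pref x (c2in γ n).length) ∧
  Tendsto (fun n => (c2in γ n).length) atTop atTop ∧
  Tendsto (fun n => (c2out γ n).length) atTop atTop

def Comp2.OneToOne (C : Comp2 A D Q) : Prop :=
  ∀ (x x' : ℕ → A) γ γ', C.IsAccRunOn γ x → C.IsAccRunOn γ' x' →
    (∀ n, ∃ m, c2out γ n <+: c2out γ' m) → (∀ n, ∃ m, c2out γ' n <+: c2out γ m) →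
    x = x'

/-- The compression ratio `ρ(x)`. -/
noncomputable def rho [Fintype A] (x : ℕ → A) : ℝ :=
  sInf {r : ℝ | ∃ (m d : ℕ), 2 ≤ d ∧ ∃ C : Comp2 A (Fin d) (Fin m),
    C.OneDet ∧ C.OneToOne ∧ ∃ γ, C.IsAccRunOn γ x ∧
      r = Filter.liminf (fun n : ℕ =>
        (((c2out γ n).length : ℝ) * Real.log d) /
        (((c2in γ n).length : ℝ) * Real.log (Fintype.card A))) atTop}

/-- Finite-state independence. -/
def FSIndep [Fintype A] [Fintype B] (x : ℕ → A) (y : ℕ → B) : Prop :=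
  condRho x y = rho x ∧ condRho y x = rho y ∧ 0 < rho x ∧ 0 < rho y

/-! ### Oblivious selectors with two input tapes -/

/-- Types of states of a selector. -/
inductive SelTy | I | II | III

/-- An oblivious selector with first input alphabet `A` and second input alphabet `B`:
at a state of type I it reads the next symbol of the first input and selects it, at a
state of type II it reads the next symbol of the first input without selecting it, and
at a state of type III it reads the next symbol of the second input. -/
structure Sel2 (A B : Type*) where
  states : ℕ
  init : Fin states
  ty : Fin states → SelTy
  δa : Fin states → A → Fin states
  δb : Fin states → B → Fin states

/-- Configuration (current state, symbols read from `x`, symbols read from `y`)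
after `n` steps. -/
def Sel2.cfg (S : Sel2 A B) (x : ℕ → A) (y : ℕ → B) : ℕ → Fin S.states × ℕ × ℕ
  | 0 => (S.init, 0, 0)
  | n + 1 =>
    let c := S.cfg x y n
    match S.ty c.1 with
    | SelTy.I => (S.δa c.1 (x c.2.1), c.2.1 + 1, c.2.2)
    | SelTy.II => (S.δa c.1 (x c.2.1), c.2.1 + 1, c.2.2)
    | SelTy.III => (S.δb c.1 (y c.2.2), c.2.1, c.2.2 + 1)

/-- The word selected from `x` during the first `n` steps. -/
def Sel2.outList (S : Sel2 A B) (x : ℕ → A) (y : ℕ → B) (n : ℕ) : List A :=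
  (List.range n).filterMap fun i =>
    let c := S.cfg x y i
    match S.ty c.1 with
    | SelTy.I => some (x c.2.1)
    | SelTy.II => none
    | SelTy.III => none

/-! ### Oblivious one-input selection automata -/

/-- An oblivious selection automaton with a single input tape. -/
structure Sel1 (B : Type*) where
  states : ℕ
  init : Fin states
  sel : Fin states → Bool
  δ : Fin states → B → Fin states

/-- State after reading the first `n` symbols of `y`. -/
def Sel1.st (S : Sel1 B) (y : ℕ → B) : ℕ → Fin S.states
  | 0 => S.init
  | n + 1 => S.δ (S.st y n) (y n)

/-- The word selected from the first `n` symbols of `y`. -/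
def Sel1.outList (S : Sel1 B) (y : ℕ → B) (n : ℕ) : List B :=
  (List.range n).filterMap fun i => if S.sel (S.st y i) then some (y i) else none

/-! ### Shufflers -/

/-- A shuffler over the alphabet `A`: at a state of type I it reads, outputs and moves
on the next symbol of the first input; at a state of type II it does so with the second
input. -/
structure Shuffler (A : Type*) where
  states : ℕ
  init : Fin states
  tyI : Fin states → Bool
  δ : Fin states → A → Fin states

/-- Configuration (current state, symbols read from `x`, symbols read from `y`)
after `n` steps. -/
def Shuffler.cfg (S : Shuffler A) (x y : ℕ → A) : ℕ → Fin S.states × ℕ × ℕ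
  | 0 => (S.init, 0, 0)
  | n + 1 =>
    let c := S.cfg x y n
    if S.tyI c.1 then (S.δ c.1 (x c.2.1), c.2.1 + 1, c.2.2)
    else (S.δ c.1 (y c.2.2), c.2.1, c.2.2 + 1)

/-- The output `S(x,y)` of the shuffler `S` on inputs `x` and `y`. -/
def Shuffler.out (S : Shuffler A) (x y : ℕ → A) (n : ℕ) : A :=
  let c := S.cfg x y n
  if S.tyI c.1 then x c.2.1 else y c.2.2

/-! ### Look-ahead automata -/

/-- The transitions of the look-ahead automaton `𝒜_{k,ℓ}`. -/
def lookTrans (M : TwoAut A B Q) (k ℓ : ℕ) :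
    Set ((Q × List A × List B) × (Option A × Option B) × (Q × List A × List B)) :=
  {t | (∃ (q : Q) (u : List A) (a : A), u.length < k ∧
          t = ((q, u, []), (some a, none), (q, u ++ [a], ([] : List B)))) ∨
       (∃ (q : Q) (u : List A) (v : List B) (b : B), u.length = k ∧ v.length < ℓ ∧
          t = ((q, u, v), (none, some b), (q, u, v ++ [b]))) ∨
       (∃ (q q' : Q) (a a' : A) (u' : List A) (v : List B),
          u'.length = k - 1 ∧ v.length = ℓ ∧ (q, (some a, none), q') ∈ M.trans ∧
          t = ((q, a :: u', v), (some a', none), (q', u' ++ [a'], v))) ∨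
       (∃ (q q' : Q) (b b' : B) (u : List A) (v' : List B),
          u.length = k ∧ v'.length = ℓ - 1 ∧ (q, (none, some b), q') ∈ M.trans ∧
          t = ((q, u, b :: v'), (none, some b'), (q', u, v' ++ [b'])))}

/-- The (finite) set of states of the look-ahead automaton with full buffers,
i.e. `Q × A^k × B^ℓ`. -/
noncomputable def fullFinset (Q A B : Type*) [Fintype Q] [Fintype A] [Fintype B]
    (k ℓ : ℕ) : Finset (Q × List A × List B) :=
  letI := Classical.decEq (Q × List A × List B)
  (Finset.univ : Finset (Q × (Fin k → A) × (Fin ℓ → B))).image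
    fun s => (s.1, List.ofFn s.2.1, List.ofFn s.2.2)

/-! ### Counting words and measures -/

/-- The number of words of length `n` with exactly `i` occurrences of `γ`. -/
noncomputable def Ncount (γ : List A) (i n : ℕ) : ℕ :=
  Nat.card {w : List A // w.length = n ∧ occ w γ = i}

/-- The cylinder of infinite words starting with `w`. -/
def cylinder (w : List A) : Set (ℕ → A) := {x : ℕ → A | pref x w.length = w}

/-- The set `E_S(ε,γ,n)` of pairs of inputs for which the frequency of `γ` in the first
`n` symbols of `S(x,y)` deviates from `|A|^{-|γ|}` by less than `ε`. -/
def Eset [Fintype A] (S : Shuffler A) (ε : ℝ) (γ : List A) (n : ℕ) :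
    Set ((ℕ → A) × (ℕ → A)) :=
  {p : (ℕ → A) × (ℕ → A) |
    |(occ (pref (S.out p.1 p.2) n) γ : ℝ) - (n : ℝ) / (Fintype.card A : ℝ) ^ γ.length|
      < ε * n}

/-- The set `F(ε,t,ℓ,n)`. -/
def Fset [Fintype A] (S : ℕ → Shuffler A) (ε : ℝ) (t ℓ n : ℕ) :
    Set ((ℕ → A) × (ℕ → A)) :=
  ⋂ i ∈ Finset.Icc 1 t, ⋂ r ∈ Finset.Icc 1 ℓ,
    ⋂ γ ∈ {γ : List A | γ.length = r}, Eset (S i) ε γ n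

/-- `ℓ_n = (log_{|A|} n)/3`. -/
noncomputable def ellSeq (A : Type*) [Fintype A] (n : ℕ) : ℝ :=
  Real.logb (Fintype.card A) n / 3

/-- `ε_n = 2 √((log n · log_{|A|} n)/n)`. -/
noncomputable def epsSeq (A : Type*) [Fintype A] (n : ℕ) : ℝ :=
  2 * Real.sqrt (Real.log n * Real.logb (Fintype.card A) n / n)

/-- `F_n = F(ε_n, t_n, ℓ_n, n)` with `t_n = n`. -/
noncomputable def Fn [Fintype A] (S : ℕ → Shuffler A) (n : ℕ) :
    Set ((ℕ → A) × (ℕ → A)) :=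
  Fset S (epsSeq A n) n (⌊ellSeq A n⌋).toNat n

/-- `n_start`, the least `n` such that `ε_n ≥ 6/⌊n/ℓ_n⌋`. -/
noncomputable def nStart (A : Type*) [Fintype A] : ℕ :=
  sInf {m : ℕ | 0 < ⌊(m : ℝ) / ellSeq A m⌋ ∧
    6 / ((⌊(m : ℝ) / ellSeq A m⌋ : ℤ) : ℝ) ≤ epsSeq A m}

/-- `G_n = ⋂_{j=0}^{n} F_{|A|^{n_0+j}}` where `|A|^{n_0} = n_start`. -/
noncomputable def Gn [Fintype A] (S : ℕ → Shuffler A) (n : ℕ) :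
    Set ((ℕ → A) × (ℕ → A)) :=
  ⋂ j ∈ Finset.range (n + 1), Fn S (nStart A * Fintype.card A ^ j)


/-! ### The output of a shuffler on random inputs -/

open MeasureTheory ProbabilityTheory

/-- The measurable sets of infinite words do not distinguish two letters that are not
distinguished by any measurable set of letters. -/
lemma update_preimage_eq_of_measurableSet [MeasurableSpace A] [DecidableEq A] {a b : A}
    (hab : ∀ s : Set A, MeasurableSet s → (a ∈ s ↔ b ∈ s)) {E : Set (ℕ → A)}
    (hE : MeasurableSet E) :
    (fun (x : ℕ → A) i => if x i = b then a else x i) ⁻¹' E = E := by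
  set Φ : (ℕ → A) → (ℕ → A) := fun x i => if x i = b then a else x i with hΦ
  let m' : MeasurableSpace (ℕ → A) :=
    { MeasurableSet' := fun E => Φ ⁻¹' E = E
      measurableSet_empty := rfl
      measurableSet_compl := fun s hs => by rw [Set.preimage_compl, hs]
      measurableSet_iUnion := fun f hf => by simp only [Set.preimage_iUnion, hf] }
  have hle : (MeasurableSpace.pi : MeasurableSpace (ℕ → A)) ≤ m' := by
    refine iSup_le fun i => ?_
    rintro _ ⟨s, hs, rfl⟩
    change Φ ⁻¹' _ = _
    ext x
    simp only [hΦ, Set.mem_preimage]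
    split_ifs with h
    · rw [h]
      exact hab s hs
    · rfl
  exact hle E hE

/-- If all cylinders have the uniform Bernoulli (outer) measure, then letters are measurable. -/
lemma measurableSingletonClass_of_cylinder [Fintype A] [MeasurableSpace A]
    (hA : 2 ≤ Fintype.card A) (μ : Measure (ℕ → A)) [IsProbabilityMeasure μ]
    (hμ : ∀ w : List A, μ (cylinder w) = (Fintype.card A : ENNReal)⁻¹ ^ w.length) :
    MeasurableSingletonClass A := by
  classical
  have hsep : ∀ a b : A, a ≠ b → ∃ s : Set A, MeasurableSet s ∧ a ∈ s ∧ b ∉ s := by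
    intro a b hne
    by_contra! hcon
    have hab : ∀ s : Set A, MeasurableSet s → (a ∈ s ↔ b ∈ s) := fun s hs =>
      ⟨hcon s hs, fun hb => by
        by_contra ha
        exact hcon sᶜ hs.compl ha hb⟩
    have hone : ∀ c, μ (toMeasurable μ (cylinder [c])) = (Fintype.card A : ENNReal)⁻¹ := by
      intro c
      rw [measure_toMeasurable, hμ]
      simp
    have hcover : (Set.univ : Set (ℕ → A)) ⊆
        ⋃ c ∈ Finset.univ.erase b, toMeasurable μ (cylinder [c]) := by
      intro x _
      rw [Set.mem_iUnion₂]
      by_cases hx : x 0 = b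
      · refine ⟨a, by simp [hne], ?_⟩
        rw [← update_preimage_eq_of_measurableSet hab (measurableSet_toMeasurable μ _)]
        apply subset_toMeasurable
        simp [cylinder, pref, hx]
      · refine ⟨x 0, by simp [hx], ?_⟩
        apply subset_toMeasurable
        simp [cylinder, pref]
    have h1 := (measure_mono hcover).trans (measure_biUnion_finset_le (μ := μ) _ _)
    simp only [hone, measure_univ, Finset.sum_const, Finset.card_erase_of_mem (Finset.mem_univ b),
      Finset.card_univ, nsmul_eq_mul] at h1
    have h2 : ((Fintype.card A - 1 : ℕ) : ENNReal) * (Fintype.card A : ENNReal)⁻¹ < 1 := by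
      rw [← div_eq_mul_inv]
      apply ENNReal.div_lt_of_lt_mul
      rw [one_mul]
      exact_mod_cast (by omega : Fintype.card A - 1 < Fintype.card A)
    exact absurd h1 (not_le.mpr h2)
  refine ⟨fun a => ?_⟩
  choose! s hs has hbs using fun b (h : a ≠ b) => hsep a b h
  have : ({a} : Set A) = ⋂ b ∈ {b : A | a ≠ b}, s b := by
    ext c
    simp only [Set.mem_singleton_iff, Set.mem_iInter, Set.mem_ofPred_eq]
    constructor
    · rintro rfl b hb
      exact has b hb
    · intro h
      by_contra hc
      exact hbs c (Ne.symm hc) (h c (Ne.symm hc))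
  rw [this]
  exact MeasurableSet.biInter (Set.to_countable _) fun b hb => hs b hb

lemma pref_succ (x : ℕ → A) (n : ℕ) : pref x (n + 1) = pref x n ++ [x n] := by
  simp [pref, List.range_succ]

lemma mem_cylinder_append_singleton (x : ℕ → A) (u : List A) (a : A) :
    x ∈ cylinder (u ++ [a]) ↔ x ∈ cylinder u ∧ x u.length = a := by
  have hlen : (pref x u.length).length = u.length := by simp [pref]
  simp only [cylinder, Set.mem_ofPred_eq, List.length_append, List.length_singleton, pref_succ]
  constructor
  · intro h
    have := List.append_inj h hlen
    simpa using this
  · rintro ⟨h1, h2⟩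
    rw [h1, h2]

/-- The pairs of inputs on which a shuffler outputs a given prefix form a product of
cylinders. -/
lemma Shuffler.exists_cylinder_prod (S : Shuffler A) (w : ℕ → A) (n : ℕ) :
    ∃ (q : Fin S.states) (u v : List A), u.length + v.length = n ∧
      {p : (ℕ → A) × (ℕ → A) | ∀ i < n, S.out p.1 p.2 i = w i} = cylinder u ×ˢ cylinder v ∧
      ∀ p ∈ cylinder u ×ˢ cylinder v, S.cfg p.1 p.2 n = (q, u.length, v.length) := by
  induction n with
  | zero =>
    refine ⟨S.init, [], [], rfl, ?_, fun p _ => rfl⟩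
    ext p
    simp [cylinder, pref]
  | succ n ih =>
    obtain ⟨q, u, v, hlen, hset, hcfg⟩ := ih
    have hmem : ∀ p : (ℕ → A) × (ℕ → A), (∀ i < n + 1, S.out p.1 p.2 i = w i) ↔
        p ∈ cylinder u ×ˢ cylinder v ∧ S.out p.1 p.2 n = w n := by
      intro p
      rw [← hset, Nat.forall_lt_succ_right]
      rfl
    by_cases hq : S.tyI q
    · refine ⟨S.δ q (w n), u ++ [w n], v, by simp; omega, ?_, ?_⟩
      · ext p
        rw [Set.mem_ofPred_eq, hmem, Set.mem_prod, Set.mem_prod, mem_cylinder_append_singleton]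
        constructor
        · rintro ⟨hp, ho⟩
          have := hcfg p hp
          simp only [Shuffler.out, this, hq, if_true] at ho
          exact ⟨⟨hp.1, ho⟩, hp.2⟩
        · rintro ⟨⟨h1, h2⟩, h3⟩
          refine ⟨⟨h1, h3⟩, ?_⟩
          simp [Shuffler.out, hcfg p ⟨h1, h3⟩, hq, h2]
      · rintro p ⟨h1, h3⟩
        rw [mem_cylinder_append_singleton] at h1
        simp [Shuffler.cfg, hcfg p ⟨h1.1, h3⟩, hq, h1.2]
    · refine ⟨S.δ q (w n), u, v ++ [w n], by simp; omega, ?_, ?_⟩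
      · ext p
        rw [Set.mem_ofPred_eq, hmem, Set.mem_prod, Set.mem_prod, mem_cylinder_append_singleton]
        constructor
        · rintro ⟨hp, ho⟩
          have := hcfg p hp
          simp only [Shuffler.out, this, hq] at ho
          exact ⟨hp.1, hp.2, by simpa using ho⟩
        · rintro ⟨h1, h2, h3⟩
          refine ⟨⟨h1, h2⟩, ?_⟩
          simp [Shuffler.out, hcfg p ⟨h1, h2⟩, hq, h3]
      · rintro p ⟨h1, h3⟩
        rw [mem_cylinder_append_singleton] at h3
        simp [Shuffler.cfg, hcfg p ⟨h1, h3.1⟩, hq, h3.2]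

/-- Every output prefix of length `n` has probability `|A|^{-n}`. -/
lemma Shuffler.measure_out_eq [Fintype A] [MeasurableSpace A] (μ : Measure (ℕ → A))
    [IsProbabilityMeasure μ]
    (hμ : ∀ w : List A, μ (cylinder w) = (Fintype.card A : ENNReal)⁻¹ ^ w.length)
    (S : Shuffler A) (w : ℕ → A) (n : ℕ) :
    (μ.prod μ) {p | ∀ i < n, S.out p.1 p.2 i = w i} = (Fintype.card A : ENNReal)⁻¹ ^ n := by
  obtain ⟨_, u, v, hlen, hset, -⟩ := S.exists_cylinder_prod w n
  rw [hset, Measure.prod_prod, hμ, hμ, ← pow_add, hlen]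

lemma Shuffler.measurable_out [Fintype A] [MeasurableSpace A] [MeasurableSingletonClass A]
    (S : Shuffler A) (n : ℕ) :
    Measurable fun p : (ℕ → A) × (ℕ → A) => S.out p.1 p.2 n := by
  have heval : Measurable fun z : (ℕ → A) × ℕ => z.1 z.2 :=
    measurable_from_prod_countable_left fun k => measurable_pi_apply k
  have hsel : Measurable fun z : (Fin S.states × A) × A => if S.tyI z.1.1 then z.1.2 else z.2 :=
    measurable_of_countable _
  have hstep : Measurable fun z : ((Fin S.states × ℕ × ℕ) × A) × A =>
      (if S.tyI z.1.1.1 then (S.δ z.1.1.1 z.1.2, z.1.1.2.1 + 1, z.1.1.2.2)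
        else (S.δ z.1.1.1 z.2, z.1.1.2.1, z.1.1.2.2 + 1) : Fin S.states × ℕ × ℕ) :=
    measurable_of_countable _
  have hcfg : ∀ m, Measurable fun p : (ℕ → A) × (ℕ → A) => S.cfg p.1 p.2 m := by
    intro m
    induction m with
    | zero => exact measurable_const
    | succ m ih =>
      exact hstep.comp ((ih.prodMk (heval.comp (measurable_fst.prodMk ih.snd.fst))).prodMk
        (heval.comp (measurable_snd.prodMk ih.snd.snd)))
  have h := hcfg n
  exact hsel.comp ((h.fst.prodMk (heval.comp (measurable_fst.prodMk h.snd.fst))).prodMk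
        (heval.comp (measurable_snd.prodMk h.snd.snd)))

lemma Shuffler.measurable_out_prefix [Fintype A] [MeasurableSpace A] [MeasurableSingletonClass A]
    (S : Shuffler A) (n : ℕ) :
    Measurable fun (p : (ℕ → A) × (ℕ → A)) (i : Fin n) => S.out p.1 p.2 i :=
  measurable_pi_lambda _ fun i => S.measurable_out i

/-- The joint law of the first `n` output letters is uniform. -/
lemma Shuffler.map_out_eq_pi [Fintype A] [Nonempty A] [MeasurableSpace A]
    [MeasurableSingletonClass A] (μ : Measure (ℕ → A)) [IsProbabilityMeasure μ]
    (hμ : ∀ w : List A, μ (cylinder w) = (Fintype.card A : ENNReal)⁻¹ ^ w.length)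
    (S : Shuffler A) (n : ℕ) :
    (μ.prod μ).map (fun p (i : Fin n) => S.out p.1 p.2 i) =
      Measure.pi fun _ : Fin n => (PMF.uniformOfFintype A).toMeasure := by
  refine Measure.ext_of_singleton fun w => ?_
  rw [Measure.pi_singleton, Measure.map_apply
    (S.measurable_out_prefix n) (measurableSet_singleton w)]
  have hset : (fun (p : (ℕ → A) × (ℕ → A)) (i : Fin n) => S.out p.1 p.2 i) ⁻¹' {w} =
      {p | ∀ i < n, S.out p.1 p.2 i =
        (fun i => if h : i < n then w ⟨i, h⟩ else Classical.arbitrary A) i} := by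
    ext p
    simp only [Set.mem_preimage, Set.mem_singleton_iff, funext_iff, Fin.forall_iff,
      Set.mem_ofPred_eq]
    refine forall₂_congr fun i hi => ?_
    simp [hi]
  rw [hset, S.measure_out_eq μ hμ]
  simp_rw [PMF.toMeasure_apply_singleton _ _ (measurableSet_singleton _)]
  simp

lemma Shuffler.map_out_apply [Fintype A] [Nonempty A] [MeasurableSpace A]
    [MeasurableSingletonClass A] (μ : Measure (ℕ → A)) [IsProbabilityMeasure μ]
    (hμ : ∀ w : List A, μ (cylinder w) = (Fintype.card A : ENNReal)⁻¹ ^ w.length)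
    (S : Shuffler A) (i : ℕ) :
    (μ.prod μ).map (fun p => S.out p.1 p.2 i) = (PMF.uniformOfFintype A).toMeasure := by
  have h := (measurePreserving_eval
    (fun _ : Fin (i + 1) => (PMF.uniformOfFintype A).toMeasure) (Fin.last i)).map_eq
  rw [← S.map_out_eq_pi μ hμ (i + 1), Measure.map_map (measurable_pi_apply _)
    (S.measurable_out_prefix _)] at h
  exact h

lemma Shuffler.iIndepFun_out [Fintype A] [Nonempty A] [MeasurableSpace A]
    [MeasurableSingletonClass A] (μ : Measure (ℕ → A)) [IsProbabilityMeasure μ]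
    (hμ : ∀ w : List A, μ (cylinder w) = (Fintype.card A : ENNReal)⁻¹ ^ w.length)
    (S : Shuffler A) :
    iIndepFun (fun i (p : (ℕ → A) × (ℕ → A)) => S.out p.1 p.2 i) (μ.prod μ) := by
  rw [iIndepFun_iff_finset]
  intro s
  obtain ⟨n, hn⟩ := s.exists_nat_subset_range
  have hfin : iIndepFun (fun (i : Fin n) (p : (ℕ → A) × (ℕ → A)) => S.out p.1 p.2 i)
      (μ.prod μ) := by
    rw [iIndepFun_iff_map_fun_eq_pi_map
      fun i : Fin n => (S.measurable_out (i : ℕ)).aemeasurable, S.map_out_eq_pi μ hμ]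
    simp only [S.map_out_apply μ hμ]
  exact hfin.precomp (g := fun i : s => ⟨i, Finset.mem_range.1 (hn i.2)⟩) fun a b h =>
    Subtype.ext (Fin.mk.inj_iff.1 h)

/-! ### Concentration of block frequencies -/

/-- Independent random variables indexed by pairs may be grouped into independent tuples. -/
lemma iIndepFun_curry {Ω ι κ E : Type*} [MeasurableSpace Ω] [MeasurableSpace E]
    {P : Measure Ω} {X : ι × κ → Ω → E} (hX : ∀ p, Measurable (X p))
    (hind : iIndepFun X P) : iIndepFun (fun i ω j => X (i, j) ω) P := by
  have := hind.isProbabilityMeasure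
  have hprob : ∀ p, IsProbabilityMeasure (P.map (X p)) :=
    fun p => Measure.isProbabilityMeasure_map (hX p).aemeasurable
  have hrow : ∀ i, P.map (fun ω j => X (i, j) ω) =
      Measure.infinitePi fun j => P.map (X (i, j)) := fun i =>
    (hind.precomp (g := fun j : κ => (i, j)) fun a b h => (Prod.mk.inj h).2
      ).map_fun_eq_infinitePi_map fun j => hX (i, j)
  rw [iIndepFun_iff_map_fun_eq_infinitePi_map
    (fun i => measurable_pi_lambda _ fun j => hX (i, j))]
  simp only [hrow]
  have hc := Measure.infinitePi_map_curry (fun i j => P.map (X (i, j)))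
  rw [← hc]
  have hall := hind.map_fun_eq_infinitePi_map hX
  rw [← hall, Measure.map_map (by fun_prop) (measurable_pi_lambda _ hX)]
  rfl

open Classical in
/-- The indicator of the word `g` occurring in `x` at position `i`. -/
noncomputable def blockInd {r : ℕ} (g : Fin r → A) (x : ℕ → A) (i : ℕ) : ℝ :=
  if (fun t : Fin r => x (i + t)) = g then 1 else 0

lemma blockInd_mem_Icc {r : ℕ} (g : Fin r → A) (x : ℕ → A) (i : ℕ) :
    blockInd g x i ∈ Set.Icc (0 : ℝ) 1 := by
  unfold blockInd
  split_ifs <;> simp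

lemma sum_range_mul_eq_sum_residues (f : ℕ → ℝ) (r N : ℕ) :
    ∑ i ∈ Finset.range (N * r), f i =
      ∑ j ∈ Finset.range r, ∑ m ∈ Finset.range N, f (j + m * r) := by
  rw [Finset.sum_comm]
  induction N with
  | zero => simp
  | succ N ih =>
    rw [add_mul, one_mul, Finset.sum_range_add, ih, Finset.sum_range_succ]
    simp only [add_comm]

section Blocks

variable {Ω : Type*} [MeasurableSpace Ω] [Fintype A] [MeasurableSpace A]
  [MeasurableSingletonClass A]

lemma integral_blockInd {P : Measure Ω} [IsProbabilityMeasure P] {X : ℕ → Ω → A}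
    (hX : ∀ i, Measurable (X i)) (hind : iIndepFun X P)
    (hunif : ∀ i a, P (X i ⁻¹' {a}) = (Fintype.card A : ENNReal)⁻¹)
    {r : ℕ} (g : Fin r → A) (i : ℕ) :
    ∫ ω, blockInd g (fun n => X n ω) i ∂P = ((Fintype.card A : ℝ) ^ r)⁻¹ := by
  have hblock : iIndepFun (fun t : Fin r => X (i + t)) P :=
    hind.precomp (g := fun t : Fin r => i + (t : ℕ)) fun a b h => Fin.ext (by simpa using h)
  have hm : ∀ t : Fin r, MeasurableSet (X (i + t) ⁻¹' {g t}) :=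
    fun t => hX _ (measurableSet_singleton _)
  have hP : P (⋂ t : Fin r, X (i + t) ⁻¹' {g t}) = (Fintype.card A : ENNReal)⁻¹ ^ r := by
    rw [hblock.meas_iInter fun t => ⟨{g t}, measurableSet_singleton _, rfl⟩]
    simp [hunif]
  have hfun : (fun ω => blockInd g (fun n => X n ω) i) =
      (⋂ t : Fin r, X (i + t) ⁻¹' {g t}).indicator 1 := by
    classical
    ext ω
    rw [Set.indicator_apply]
    simp [blockInd, funext_iff]
  rw [hfun, integral_indicator_one (MeasurableSet.iInter hm), measureReal_def, hP]
  simp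

/-- Hoeffding's inequality for the occurrences of a word at the positions of a fixed residue. -/
lemma measure_residue_class_le {P : Measure Ω} [IsProbabilityMeasure P] {X : ℕ → Ω → A}
    (hX : ∀ i, Measurable (X i)) (hind : iIndepFun X P)
    (hunif : ∀ i a, P (X i ⁻¹' {a}) = (Fintype.card A : ENNReal)⁻¹)
    {r : ℕ} (g : Fin r → A) (j N : ℕ) {s : ℝ} (hs : 0 ≤ s) :
    P.real {ω | s ≤ |∑ m ∈ Finset.range N,
      (blockInd g (fun n => X n ω) (j + m * r) - ((Fintype.card A : ℝ) ^ r)⁻¹)|} ≤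
      2 * Real.exp (-2 * s ^ 2 / N) := by
  classical
  set p : ℝ := ((Fintype.card A : ℝ) ^ r)⁻¹
  let Y : ℕ → Ω → ℝ := fun m ω => blockInd g (fun n => X n ω) (j + m * r) - p
  have hYeq : ∀ m ω, Y m ω =
      (fun h : Fin r → A => (if h = g then (1 : ℝ) else 0) - p) fun t => X (j + m * r + t) ω :=
    fun m ω => by simp only [Y, blockInd]
  have hinj : Function.Injective fun q : ℕ × Fin r => j + q.1 * r + (q.2 : ℕ) := by
    rintro ⟨a, b⟩ ⟨c, d⟩ h
    have hr : 0 < r := b.pos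
    have h' : (b : ℕ) + r * a = d + r * c := by
      simp only at h
      rw [mul_comm r a, mul_comm r c]
      omega
    have hdiv := congrArg (· / r) h'
    have hmod := congrArg (· % r) h'
    simp only [Nat.add_mul_div_left _ _ hr, Nat.div_eq_of_lt b.2, Nat.div_eq_of_lt d.2,
      Nat.add_mul_mod_self_left, Nat.mod_eq_of_lt b.2, Nat.mod_eq_of_lt d.2, zero_add] at hdiv hmod
    rw [Prod.mk.injEq, Fin.ext_iff]
    exact ⟨hdiv, hmod⟩
  have hindY : iIndepFun Y P := by
    have h1 := iIndepFun_curry (fun q : ℕ × Fin r => hX (j + q.1 * r + (q.2 : ℕ)))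
      (hind.precomp hinj)
    exact h1.comp (fun _ (h : Fin r → A) => (if h = g then (1 : ℝ) else 0) - p)
      fun _ => measurable_of_countable _
  have hmeas : ∀ m, Measurable fun ω => blockInd g (fun n => X n ω) (j + m * r) := fun m =>
    (measurable_of_countable fun h : Fin r → A => if h = g then (1 : ℝ) else 0).comp
      (measurable_pi_lambda _ fun t => hX (j + m * r + t))
  have hsub : ∀ m, HasSubgaussianMGF (Y m) ((‖(1 : ℝ) - 0‖₊ / 2) ^ 2) P := by
    intro m
    have h := hasSubgaussianMGF_of_mem_Icc (hmeas m).aemeasurable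
      (ae_of_all P fun ω => blockInd_mem_Icc g (fun n => X n ω) (j + m * r))
    rwa [integral_blockInd hX hind hunif] at h
  have hexp : -s ^ 2 / (2 * N * (((‖(1 : ℝ) - 0‖₊ / 2) ^ 2 : NNReal) : ℝ)) = -2 * s ^ 2 / N := by
    have : (((‖(1 : ℝ) - 0‖₊ / 2) ^ 2 : NNReal) : ℝ) = 1 / 4 := by
      simp
      norm_num
    rw [this]
    rcases eq_or_ne (N : ℝ) 0 with h0 | h0
    · simp [h0]
    · field_simp
      ring
  have hup := HasSubgaussianMGF.measure_sum_range_ge_le_of_iIndepFun hindY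
    (n := N) (fun m _ => hsub m) hs
  have hlow := HasSubgaussianMGF.measure_sum_range_ge_le_of_iIndepFun
    (hindY.comp (fun _ x => -x) fun _ => measurable_neg)
    (n := N) (fun m _ => (hsub m).neg) hs
  rw [hexp] at hup hlow
  have hsubset : {ω | s ≤ |∑ m ∈ Finset.range N, Y m ω|} ⊆
      {ω | s ≤ ∑ m ∈ Finset.range N, Y m ω} ∪
        {ω | s ≤ ∑ m ∈ Finset.range N, ((fun x => -x) ∘ Y m) ω} := by
    intro ω hω
    rcases le_abs.1 (Set.mem_ofPred_eq ▸ hω) with h | h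
    · exact Or.inl h
    · right
      simpa using h
  refine (measureReal_mono hsubset).trans ((measureReal_union_le _ _).trans ?_)
  linarith

/-- Hoeffding's inequality for the (overlapping) occurrences of a word. -/
lemma measure_blockInd_sum_le {P : Measure Ω} [IsProbabilityMeasure P] {X : ℕ → Ω → A}
    (hX : ∀ i, Measurable (X i)) (hind : iIndepFun X P)
    (hunif : ∀ i a, P (X i ⁻¹' {a}) = (Fintype.card A : ENNReal)⁻¹)
    {r : ℕ} (hr : 0 < r) (g : Fin r → A) (N : ℕ) {s : ℝ} (hs : 0 < s) :
    P.real {ω | s ≤ |∑ i ∈ Finset.range (N * r),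
      (blockInd g (fun n => X n ω) i - ((Fintype.card A : ℝ) ^ r)⁻¹)|} ≤
      r * (2 * Real.exp (-2 * (s / r) ^ 2 / N)) := by
  have hr' : (0 : ℝ) < r := by exact_mod_cast hr
  have hsubset : {ω | s ≤ |∑ i ∈ Finset.range (N * r),
      (blockInd g (fun n => X n ω) i - ((Fintype.card A : ℝ) ^ r)⁻¹)|} ⊆
      ⋃ j ∈ Finset.range r, {ω | s / r ≤ |∑ m ∈ Finset.range N,
        (blockInd g (fun n => X n ω) (j + m * r) - ((Fintype.card A : ℝ) ^ r)⁻¹)|} := by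
    intro ω hω
    by_contra hcon
    simp only [Set.mem_iUnion, Set.mem_ofPred_eq, not_exists, not_le] at hcon
    rw [Set.mem_ofPred_eq, sum_range_mul_eq_sum_residues] at hω
    have h1 := hω.trans (Finset.abs_sum_le_sum_abs _ _)
    have h2 := Finset.sum_lt_sum_of_nonempty (Finset.nonempty_range_iff.2 hr.ne') hcon
    rw [Finset.sum_const, Finset.card_range, nsmul_eq_mul, mul_div_cancel₀ _ hr'.ne'] at h2
    exact absurd (h1.trans_lt h2) (lt_irrefl _)
  refine (measureReal_mono hsubset (measure_ne_top _ _)).trans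
    ((measureReal_biUnion_finset_le _ _).trans ?_)
  refine (Finset.sum_le_sum fun j _ => measure_residue_class_le hX hind hunif g j N
    (div_pos hs hr').le).trans ?_
  simp

end Blocks

lemma occ_pref_eq_sum_blockInd {r : ℕ} (g : Fin r → A) (x : ℕ → A) (n : ℕ) :
    (occ (pref x n) (List.ofFn g) : ℝ) = ∑ i ∈ Finset.range (n + 1 - r), blockInd g x i := by
  classical
  have hiff : ∀ i, i + r ≤ n →
      (((pref x n).drop i).take r = List.ofFn g ↔ (fun t : Fin r => x (i + t)) = g) := by
    intro i hi
    have : ((pref x n).drop i).take r = List.ofFn fun t : Fin r => x (i + t) := by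
      apply List.ext_getElem
      · simp only [pref, List.length_take, List.length_drop, List.length_map, List.length_range,
          List.length_ofFn]
        omega
      · intro m h1 h2
        simp [pref]
    rw [this, List.ofFn_inj]
  have hset : {i : ℕ | i + (List.ofFn g).length ≤ (pref x n).length ∧
      ((pref x n).drop i).take (List.ofFn g).length = List.ofFn g} =
      ((Finset.range (n + 1 - r)).filter fun i => (fun t : Fin r => x (i + t)) = g : Finset ℕ) := by
    ext i
    have hlen : (pref x n).length = n := by simp [pref]
    simp only [List.length_ofFn, hlen, Set.mem_ofPred_eq, Finset.coe_filter, Finset.mem_range]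
    constructor
    · rintro ⟨h1, h2⟩
      exact ⟨by omega, (hiff i h1).1 h2⟩
    · rintro ⟨h1, h2⟩
      exact ⟨by omega, (hiff i (by omega)).2 h2⟩
  unfold occ
  rw [hset, Nat.card_coe_set_eq, Set.ncard_coe_finset]
  simp [blockInd]

/-- The occurrence count differs from the sum over complete residue classes by at most the
length of the word. -/
lemma abs_occ_sub_sum_blockInd_le {r : ℕ} (hr : 0 < r) (g : Fin r → A) (x : ℕ → A) {n : ℕ}
    (hrn : r ≤ n) :
    |(occ (pref x n) (List.ofFn g) : ℝ) - ∑ i ∈ Finset.range (n / r * r), blockInd g x i| ≤ r := by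
  have h1 := Nat.div_mul_le_self n r
  have h2 := Nat.lt_div_mul_add (a := n) hr
  obtain ⟨d, hd⟩ : ∃ d, n / r * r = (n + 1 - r) + d := ⟨_, (Nat.add_sub_of_le (by omega)).symm⟩
  have hdr : (d : ℝ) ≤ r := by exact_mod_cast (by omega : d ≤ r)
  rw [occ_pref_eq_sum_blockInd, hd, Finset.sum_range_add]
  set T := ∑ m ∈ Finset.range d, blockInd g x (n + 1 - r + m) with hT
  have hT0 : 0 ≤ T := Finset.sum_nonneg fun i _ => (blockInd_mem_Icc g x _).1
  have hTd : T ≤ d := by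
    refine (Finset.sum_le_sum fun i _ => (blockInd_mem_Icc g x _).2).trans ?_
    simp
  rw [abs_le]
  constructor <;> linarith

/-- Concentration of the number of occurrences of a word in a random prefix. -/
lemma measure_occ_deviation_le {Ω : Type*} [MeasurableSpace Ω] [Fintype A] [Nonempty A]
    [MeasurableSpace A] [MeasurableSingletonClass A] {P : Measure Ω} [IsProbabilityMeasure P]
    {X : ℕ → Ω → A} (hX : ∀ i, Measurable (X i)) (hind : iIndepFun X P)
    (hunif : ∀ i a, P (X i ⁻¹' {a}) = (Fintype.card A : ENNReal)⁻¹)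
    {r n : ℕ} (hr : 0 < r) (hrn : r ≤ n) (g : Fin r → A) {δ : ℝ} (hδ : 2 * r < δ) :
    P.real {ω | δ ≤ |(occ (pref (fun i => X i ω) n) (List.ofFn g) : ℝ) -
        n / (Fintype.card A : ℝ) ^ r|} ≤
      r * (2 * Real.exp (-2 * ((δ - 2 * r) / r) ^ 2 / (n / r : ℕ))) := by
  refine (measureReal_mono ?_).trans
    (measure_blockInd_sum_le hX hind hunif hr g (n / r) (sub_pos.2 hδ))
  intro ω hω
  rw [Set.mem_ofPred_eq] at hω ⊢
  have h1 := abs_occ_sub_sum_blockInd_le hr g (fun i => X i ω) hrn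
  rw [Finset.sum_sub_distrib, Finset.sum_const, Finset.card_range, nsmul_eq_mul]
  set k : ℝ := (Fintype.card A : ℝ) ^ r
  set T := ∑ i ∈ Finset.range (n / r * r), blockInd g (fun i => X i ω) i
  set o : ℝ := (occ (pref (fun i => X i ω) n) (List.ofFn g) : ℝ)
  have hk : 1 ≤ k := one_le_pow₀ (by exact_mod_cast Fintype.card_pos (α := A))
  have hk0 : 0 ≤ k⁻¹ := inv_nonneg.2 (by linarith)
  have hk1 : k⁻¹ ≤ 1 := inv_le_one_of_one_le₀ hk
  have h2 : ((n / r * r : ℕ) : ℝ) ≤ n := by exact_mod_cast Nat.div_mul_le_self n r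
  have h3 : (n : ℝ) ≤ (n / r * r : ℕ) + r := by
    exact_mod_cast (Nat.lt_div_mul_add (a := n) hr).le
  set M : ℝ := ((n / r * r : ℕ) : ℝ)
  have h4 : |M * k⁻¹ - n / k| ≤ r := by
    rw [div_eq_mul_inv, ← sub_mul, abs_mul, abs_of_nonneg hk0, abs_sub_comm,
      abs_of_nonneg (by linarith)]
    nlinarith
  have h5 : o - n / k = (o - T) + (T - M * k⁻¹) + (M * k⁻¹ - n / k) := by ring
  have h6 := abs_add_three (o - T) (T - M * k⁻¹) (M * k⁻¹ - n / k)
  rw [← h5] at h6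
  linarith

/-- The numerical estimate behind the exponential bound for `ε_n`. -/
lemma exp_deviation_le {r n : ℕ} {l ε : ℝ} (hr : 0 < r) (hrn : r ≤ n) (hrl : r ≤ l)
    (hεn : 6 * l ≤ ε * n) (hεsq : ε ^ 2 * n = 12 * l * Real.log n) :
    Real.exp (-2 * ((ε * n - 2 * r) / r) ^ 2 / (n / r : ℕ)) ≤ ((n : ℝ) ^ 10)⁻¹ := by
  have hr' : (0 : ℝ) < r := by exact_mod_cast hr
  have hn : (0 : ℝ) < n := by exact_mod_cast hr.trans_le hrn
  have hN : (0 : ℝ) < (n / r : ℕ) := by exact_mod_cast Nat.div_pos hrn hr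
  have hNr : ((n / r : ℕ) : ℝ) * r ≤ n := by exact_mod_cast Nat.div_mul_le_self n r
  have hlog : 0 ≤ Real.log n := Real.log_natCast_nonneg n
  set N : ℝ := ((n / r : ℕ) : ℝ)
  have hpow : ((n : ℝ) ^ 10)⁻¹ = Real.exp (-(10 * Real.log n)) := by
    rw [Real.exp_neg, mul_comm, Real.exp_mul, Real.exp_log hn]
    norm_cast
  rw [hpow, Real.exp_le_exp]
  have hsq : 4 / 9 * (ε * n) ^ 2 ≤ (ε * n - 2 * r) ^ 2 := by
    have h1 : 0 ≤ 2 / 3 * (ε * n) := by nlinarith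
    have h2 : 2 / 3 * (ε * n) ≤ ε * n - 2 * r := by linarith
    calc 4 / 9 * (ε * n) ^ 2 = (2 / 3 * (ε * n)) ^ 2 := by ring
      _ ≤ _ := pow_le_pow_left₀ h1 h2 2
  have hval : (ε * n) ^ 2 = 12 * l * Real.log n * n := by rw [← hεsq]; ring
  have hmain : 10 * Real.log n * (r ^ 2 * N) ≤ 2 * (ε * n - 2 * r) ^ 2 := by
    have h1 : (r : ℝ) ^ 2 * N ≤ l * n := by
      calc (r : ℝ) ^ 2 * N = r * (N * r) := by ring
        _ ≤ l * n := mul_le_mul hrl hNr (by positivity) (by linarith)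
    have h2 := mul_le_mul_of_nonneg_left h1 hlog
    have h3 : 0 ≤ Real.log n * (l * n) := mul_nonneg hlog (by nlinarith)
    nlinarith
  have : 10 * Real.log n ≤ 2 * (ε * n - 2 * r) ^ 2 / (r ^ 2 * N) := by
    rwa [le_div_iff₀ (by positivity)]
  have heq : -2 * ((ε * n - 2 * r) / r) ^ 2 / N = -(2 * (ε * n - 2 * r) ^ 2 / (r ^ 2 * N)) := by
    field_simp
  rw [heq]
  linarith

/-- The probability that a shuffler fails the frequency condition for one word. -/
lemma Shuffler.measure_compl_Eset_le [Fintype A] [Nonempty A] [MeasurableSpace A]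
    [MeasurableSingletonClass A] (μ : Measure (ℕ → A)) [IsProbabilityMeasure μ]
    (hμ : ∀ w : List A, μ (cylinder w) = (Fintype.card A : ENNReal)⁻¹ ^ w.length)
    (S : Shuffler A) {r n : ℕ} {l ε : ℝ} (hr : 0 < r) (hrn : r ≤ n) (hrl : r ≤ l)
    (hεn : 6 * l ≤ ε * n) (hεsq : ε ^ 2 * n = 12 * l * Real.log n) (g : Fin r → A) :
    (μ.prod μ).real (Eset S ε (List.ofFn g) n)ᶜ ≤ r * (2 * ((n : ℝ) ^ 10)⁻¹) := by
  have hr' : (0 : ℝ) < r := by exact_mod_cast hr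
  have hunif : ∀ i a, (μ.prod μ) ((fun p => S.out p.1 p.2 i) ⁻¹' {a}) =
      (Fintype.card A : ENNReal)⁻¹ := by
    intro i a
    rw [← Measure.map_apply (S.measurable_out i) (measurableSet_singleton a),
      S.map_out_apply μ hμ, PMF.toMeasure_apply_singleton _ _ (measurableSet_singleton _)]
    simp
  have h := measure_occ_deviation_le (P := μ.prod μ) S.measurable_out
    (S.iIndepFun_out μ hμ) hunif hr hrn g (δ := ε * n) (by linarith)
  have hset : (Eset S ε (List.ofFn g) n)ᶜ = {p : (ℕ → A) × (ℕ → A) |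
      ε * n ≤ |(occ (pref (fun i => S.out p.1 p.2 i) n) (List.ofFn g) : ℝ) -
        n / (Fintype.card A : ℝ) ^ r|} := by
    ext p
    simp [Eset]
  rw [hset]
  refine h.trans ?_
  gcongr
  exact exp_deviation_le hr hrn hrl hεn hεsq

lemma compl_Fset_subset [Fintype A] (S : ℕ → Shuffler A) (ε : ℝ) (t ℓ n : ℕ) :
    (Fset S ε t ℓ n)ᶜ ⊆ ⋃ i ∈ Finset.Icc 1 t, ⋃ r ∈ Finset.Icc 1 ℓ,
      ⋃ g ∈ (Finset.univ : Finset (Fin r → A)), (Eset (S i) ε (List.ofFn g) n)ᶜ := by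
  intro p hp
  simp only [Fset, Set.mem_compl_iff, Set.mem_iInter, not_forall, Set.mem_ofPred_eq] at hp
  obtain ⟨i, hi, r, hr, γ, rfl, hγ⟩ := hp
  simp only [Set.mem_iUnion]
  exact ⟨i, hi, _, hr, γ.get, Finset.mem_univ _, by rwa [List.ofFn_get]⟩

open MeasureTheory in
/-- For every `n` with `ε_n ≥ 6/⌊n/ℓ_n⌋`, the set
`F_n = F(ε_n, t_n, ℓ_n, n)` has measure at least `1 - 1/n²`. -/
theorem Fn_measure_bound {A : Type*} [Fintype A] [MeasurableSpace A]
    (hA : 2 ≤ Fintype.card A)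
    (μ : Measure (ℕ → A)) [IsProbabilityMeasure μ]
    (hμ : ∀ w : List A, μ (cylinder w) = (Fintype.card A : ENNReal)⁻¹ ^ w.length)
    (S : ℕ → Shuffler A) (n : ℕ) (hn : 0 < n)
    (hfloor : 0 < ⌊(n : ℝ) / ellSeq A n⌋)
    (hε : 6 / ((⌊(n : ℝ) / ellSeq A n⌋ : ℤ) : ℝ) ≤ epsSeq A n) :
    1 - 1 / (n : ℝ) ^ 2 ≤ ((μ.prod μ) (Fn S n)).toReal := by
  classical
  have hsing := measurableSingletonClass_of_cylinder hA μ hμ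
  have : Nonempty A := Fintype.card_pos_iff.1 (by omega)
  have hk : (1 : ℝ) < Fintype.card A := by exact_mod_cast (by omega : 1 < Fintype.card A)
  have hn0 : (0 : ℝ) < n := by exact_mod_cast hn
  set l := ellSeq A n with hl
  set ε := epsSeq A n with hεdef
  have hfloorR : (1 : ℝ) ≤ (⌊(n : ℝ) / l⌋ : ℤ) := by exact_mod_cast hfloor
  have hdiv : 1 ≤ (n : ℝ) / l := hfloorR.trans (Int.floor_le _)
  have hlpos : 0 < l := by
    by_contra h
    have := div_nonpos_of_nonneg_of_nonpos hn0.le (not_lt.1 h)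
    linarith
  have hln : l ≤ n := by rwa [one_le_div hlpos] at hdiv
  have hlogb : Real.logb (Fintype.card A) n = 3 * l := by rw [hl, ellSeq]; ring
  have hn2 : 2 ≤ n := by
    by_contra h
    have h1 : n = 1 := by omega
    rw [h1, Nat.cast_one, Real.logb_one] at hlogb
    linarith
  have hεn : 6 * l ≤ ε * n := by
    have h1 : 6 / ((n : ℝ) / l) ≤ 6 / ((⌊(n : ℝ) / l⌋ : ℤ) : ℝ) :=
      div_le_div_of_nonneg_left (by norm_num) (by linarith) (Int.floor_le _)
    have h2 := h1.trans hε
    rwa [div_div_eq_mul_div, div_le_iff₀ hn0] at h2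
  have hεsq : ε ^ 2 * n = 12 * l * Real.log n := by
    have hlog : 0 ≤ Real.log n := Real.log_natCast_nonneg n
    rw [hεdef, epsSeq, hlogb, mul_pow, Real.sq_sqrt (by positivity)]
    field_simp
    ring
  have hbad : (μ.prod μ).real (Fn S n)ᶜ ≤ 1 / (n : ℝ) ^ 2 := by
    have hrfacts : ∀ r ∈ Finset.Icc 1 ⌊l⌋.toNat, 0 < r ∧ (r : ℝ) ≤ l ∧ r ≤ n := by
      intro r hr
      rw [Finset.mem_Icc] at hr
      have h1 : (r : ℤ) ≤ ⌊l⌋ := by omega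
      have h2 : (r : ℝ) ≤ l := by exact_mod_cast Int.le_floor.1 h1
      exact ⟨hr.1, h2, by exact_mod_cast h2.trans hln⟩
    have hword : ∀ i, ∀ r ∈ Finset.Icc 1 ⌊l⌋.toNat, (μ.prod μ).real
        (⋃ g ∈ (Finset.univ : Finset (Fin r → A)), (Eset (S i) ε (List.ofFn g) n)ᶜ) ≤
        n * (n * (2 * ((n : ℝ) ^ 10)⁻¹)) := by
      intro i r hr
      obtain ⟨hr0, hrl, hrn⟩ := hrfacts r hr
      refine (measureReal_biUnion_finset_le _ _).trans ((Finset.sum_le_sum fun g _ =>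
        (S i).measure_compl_Eset_le μ hμ hr0 hrn hrl hεn hεsq g).trans ?_)
      rw [Finset.sum_const, Finset.card_univ, Fintype.card_fun, Fintype.card_fin, nsmul_eq_mul]
      have hkr : ((Fintype.card A ^ r : ℕ) : ℝ) ≤ n := by
        push_cast
        rw [← Real.rpow_natCast, ← Real.le_logb_iff_rpow_le hk hn0, hlogb]
        linarith
      gcongr
    have hshuf : ∀ i, (μ.prod μ).real (⋃ r ∈ Finset.Icc 1 ⌊l⌋.toNat,
        ⋃ g ∈ (Finset.univ : Finset (Fin r → A)), (Eset (S i) ε (List.ofFn g) n)ᶜ) ≤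
        n * (n * (n * (2 * ((n : ℝ) ^ 10)⁻¹))) := by
      intro i
      refine (measureReal_biUnion_finset_le _ _).trans
        ((Finset.sum_le_sum (hword i)).trans ?_)
      rw [Finset.sum_const, Nat.card_Icc, nsmul_eq_mul, Nat.add_sub_cancel]
      have hL : ⌊l⌋.toNat ≤ n := by
        rw [Int.toNat_le]
        exact_mod_cast Int.floor_le_iff.2 (by push_cast; linarith)
      gcongr
    have htotal := (measureReal_mono (μ := μ.prod μ) (compl_Fset_subset S ε n ⌊l⌋.toNat n)
      (measure_ne_top _ _)).trans ((measureReal_biUnion_finset_le _ _).trans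
        (Finset.sum_le_sum fun i _ => hshuf i))
    refine htotal.trans ?_
    rw [Finset.sum_const, Nat.card_Icc, nsmul_eq_mul, Nat.add_sub_cancel]
    have hn2' : (2 : ℝ) ≤ n := by exact_mod_cast hn2
    have h2 : (2 : ℝ) ≤ (n : ℝ) ^ 4 := by
      calc (2 : ℝ) ≤ 2 ^ 4 := by norm_num
        _ ≤ _ := by gcongr
    have heq : (n : ℝ) * (n * (n * (n * (2 * ((n : ℝ) ^ 10)⁻¹)))) = 2 / (n : ℝ) ^ 6 := by
      field_simp
    rw [heq, div_le_div_iff₀ (by positivity) (by positivity), one_mul,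
      show (n : ℝ) ^ 6 = n ^ 4 * n ^ 2 by ring]
    gcongr
  have hone : (1 : ℝ) ≤ (μ.prod μ).real (Fn S n) + (μ.prod μ).real (Fn S n)ᶜ := by
    have h := measureReal_union_le (μ := μ.prod μ) (Fn S n) (Fn S n)ᶜ
    rwa [Set.union_compl_self, probReal_univ] at h
  rw [← measureReal_def]
  linarith

end FSI
end

section
/- Let A be a finite alphabet with |A| ≥ 2 and let (S_i)_{i≥1} be an enumeration of all shufflers over A (every shuffler realises the same input–output map as some S_i). For each positive integer n set ℓ_n = (log_{|A|} n)/3, t_n = n, ε_n = 2·√((log n · log_{|A|} n)/n), F_n = F(ε_n, t_n, ℓ_n, n), and let n_0 = log_{|A|} of the least n with ε_n ≥ 6/⌊n/ℓ_n⌋; define G_n = ⋂_{j=0}^{n} F_{|A|^{n_0+j}}. Then every pair (u,v) ∈ ⋂_{n≥0} G_n is a pair of normal, finite-state independent infinite words. -/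
open Filter Topology

namespace FSI

variable {A B D Q : Type*}

/-! ### Segments of infinite words -/

/-- The factor of length `L` of the infinite word `z` starting at position `i`. -/
def seg (z : ℕ → A) (i L : ℕ) : List A := (List.range L).map fun j => z (i + j)

@[simp] lemma length_seg (z : ℕ → A) (i L : ℕ) : (seg z i L).length = L := by simp [seg]

@[simp] lemma length_pref (z : ℕ → A) (n : ℕ) : (pref z n).length = n := by simp [pref]

lemma pref_add (z : ℕ → A) (i L : ℕ) : pref z (i + L) = pref z i ++ seg z i L := by
  simp [pref, seg, List.range_add, Function.comp_def]

lemma seg_add (z : ℕ → A) (i L M : ℕ) : seg z i (L + M) = seg z i L ++ seg z (i + L) M := by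
  simp [seg, List.range_add, Function.comp_def, Nat.add_assoc]

lemma seg_eq_seg_iff {z z' : ℕ → A} {i i' L : ℕ} :
    seg z i L = seg z' i' L ↔ ∀ j < L, z (i + j) = z' (i' + j) := by
  simp [seg]

lemma drop_take_pref (z : ℕ → A) {i L n : ℕ} (h : i + L ≤ n) :
    ((pref z n).drop i).take L = seg z i L := by
  obtain ⟨m, rfl⟩ := Nat.exists_eq_add_of_le h
  have h1 : pref z (i + L + m) = pref z i ++ (seg z i L ++ seg z (i + L) m) := by
    rw [Nat.add_assoc, pref_add, seg_add]
  rw [h1, List.drop_left' (length_pref z i), List.take_left' (length_seg z i L)]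

open Classical in
lemma occ_pref (z : ℕ → A) (w : List A) (n : ℕ) :
    occ (pref z n) w =
      {i ∈ Finset.range (n + 1) | i + w.length ≤ n ∧ seg z i w.length = w}.card := by
  refine Nat.subtype_card _ fun i => ?_
  simp only [Finset.mem_filter, Finset.mem_range, Set.mem_ofPred_eq, length_pref]
  constructor
  · rintro ⟨-, h1, h2⟩
    exact ⟨h1, by rw [drop_take_pref z h1, h2]⟩
  · rintro ⟨h1, h2⟩
    exact ⟨by omega, h1, by rw [← drop_take_pref z h1, h2]⟩

lemma occ_pref_mono (z : ℕ → A) (w : List A) {n m : ℕ} (h : n ≤ m) :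
    occ (pref z n) w ≤ occ (pref z m) w := by
  classical
  rw [occ_pref, occ_pref]
  refine Finset.card_le_card fun i hi => ?_
  simp only [Finset.mem_filter, Finset.mem_range] at hi ⊢
  exact ⟨by omega, by omega, hi.2.2⟩

lemma occ_pref_nil (z : ℕ → A) (n : ℕ) : occ (pref z n) [] = n + 1 := by
  classical
  rw [occ_pref, Finset.filter_true_of_mem, Finset.card_range]
  intro i hi
  simp only [Finset.mem_range] at hi
  exact ⟨by simp; omega, by simp [seg]⟩

/-! ### Frequencies up to a multiplicative constant -/

/-- The frequency of every word `w` in `z` is, up to the factor `K`, equal to `|A|^{-|w|}`. -/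
def WeaklyNormal [Fintype A] (K : ℝ) (z : ℕ → A) : Prop :=
  ∀ w : List A, ∀ᶠ n : ℕ in atTop,
    (occ (pref z n) w : ℝ) ≤ K * n / (Fintype.card A : ℝ) ^ w.length ∧
    (n : ℝ) / (Fintype.card A : ℝ) ^ w.length ≤ K * occ (pref z n) w

lemma nStart_pos [Fintype A] (hA : 2 ≤ Fintype.card A) : 0 < nStart A := by
  set k := Fintype.card A with hk
  have hk2 : (2 : ℝ) ≤ k := by exact_mod_cast hA
  have hlog : 1 / 2 ≤ Real.log k := by
    have := Real.log_le_log (by norm_num) hk2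
    have := Real.log_two_gt_d9
    linarith
  have hell : ellSeq A (k ^ (3 * k)) = k := by
    rw [ellSeq, ← hk]
    push_cast
    rw [Real.logb_pow, Real.logb_self_eq_one (by linarith)]
    push_cast
    ring
  have hkpos : 0 < k := by omega
  have hdiv : ((k ^ (3 * k) : ℕ) : ℝ) / ellSeq A (k ^ (3 * k)) = ((k ^ (3 * k - 1) : ℕ) : ℝ) := by
    rw [hell, div_eq_iff (by positivity), ← Nat.cast_mul, ← pow_succ,
      Nat.sub_add_cancel (by omega)]
  have hmem : k ^ (3 * k) ∈ {m : ℕ | 0 < ⌊(m : ℝ) / ellSeq A m⌋ ∧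
      6 / ((⌊(m : ℝ) / ellSeq A m⌋ : ℤ) : ℝ) ≤ epsSeq A m} := by
    rw [Set.mem_ofPred_eq, hdiv, Int.floor_natCast]
    refine ⟨by exact_mod_cast pow_pos hkpos _, ?_⟩
    rw [epsSeq, ← hk]
    have h3 : (6 : ℝ) / (((k ^ (3 * k - 1) : ℕ) : ℤ) : ℝ)
        = 2 * (3 * k / (k : ℝ) ^ (3 * k)) := by
      have : (k : ℝ) ^ (3 * k) = k ^ (3 * k - 1) * k := by
        rw [← pow_succ, Nat.sub_add_cancel (by omega)]
      rw [this]
      push_cast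
      field_simp
      norm_num
    rw [h3]
    refine mul_le_mul_of_nonneg_left (Real.le_sqrt_of_sq_le ?_) (by norm_num)
    push_cast
    rw [Real.logb_pow, Real.log_pow, Real.logb_self_eq_one (by linarith), div_pow,
      div_le_div_iff₀ (by positivity) (by positivity)]
    push_cast
    have h4 : (2 : ℝ) ≤ (k : ℝ) ^ (3 * k) := by
      calc (2 : ℝ) ≤ k := hk2
        _ = (k : ℝ) ^ 1 := (pow_one _).symm
        _ ≤ _ := pow_le_pow_right₀ (by linarith) (by omega)
    have h5 : 0 ≤ (k : ℝ) ^ (3 * k) * (9 * (k : ℝ) ^ 2) := by positivity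
    have h6 : 1 ≤ Real.log k * (k : ℝ) ^ (3 * k) := by nlinarith
    nlinarith [mul_le_mul_of_nonneg_left h6 h5]
  have := Nat.sInf_mem ⟨_, hmem⟩
  rcases Nat.eq_zero_or_pos (nStart A) with h0 | h0
  · have h1 : nStart A ∈ {m : ℕ | 0 < ⌊(m : ℝ) / ellSeq A m⌋ ∧
      6 / ((⌊(m : ℝ) / ellSeq A m⌋ : ℤ) : ℝ) ≤ epsSeq A m} := this
    rw [h0] at h1
    simp at h1
  · exact h0

lemma tendsto_epsSeq [Fintype A] : Tendsto (epsSeq A) atTop (𝓝 0) := by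
  have h1 : Tendsto (fun x : ℝ => Real.log x ^ 2 / x) atTop (𝓝 0) :=
    (Real.isLittleO_pow_log_id_atTop (n := 2)).tendsto_div_nhds_zero
  have h2 := (h1.comp tendsto_natCast_atTop_atTop).div_const (Real.log (Fintype.card A))
  have h3 := ((Real.continuous_sqrt.tendsto _).comp h2).const_mul 2
  simp only [zero_div, Real.sqrt_zero, mul_zero] at h3
  refine h3.congr fun n => ?_
  simp only [epsSeq, Function.comp_apply, Real.logb]
  congr 2
  ring

lemma tendsto_ellSeq [Fintype A] (hA : 2 ≤ Fintype.card A) :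
    Tendsto (ellSeq A) atTop atTop := by
  have hk2 : (1 : ℝ) < Fintype.card A := by exact_mod_cast hA
  exact ((Real.tendsto_logb_atTop hk2).comp tendsto_natCast_atTop_atTop).atTop_div_const
    (by norm_num)

lemma weaklyNormal_out [Fintype A] (hA : 2 ≤ Fintype.card A)
    (S : ℕ → Shuffler A)
    (henum : ∀ T : Shuffler A, ∃ i, 1 ≤ i ∧ ∀ x y : ℕ → A, (S i).out x y = T.out x y)
    (u v : ℕ → A) (huv : ∀ n : ℕ, (u, v) ∈ Gn S n) (T : Shuffler A) :
    WeaklyNormal (2 * Fintype.card A) (T.out u v) := by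
  set k := Fintype.card A with hk
  have hk2 : (2 : ℝ) ≤ k := by exact_mod_cast hA
  obtain ⟨i, hi1, hi⟩ := henum T
  set z := T.out u v with hz
  intro w
  rcases Nat.eq_zero_or_pos w.length with hw | hw
  · obtain rfl := List.length_eq_zero_iff.1 hw
    filter_upwards [eventually_ge_atTop 1] with n hn
    rw [occ_pref_nil]
    have : (1 : ℝ) ≤ n := by exact_mod_cast hn
    simp only [List.length_nil, pow_zero, div_one]
    push_cast
    constructor <;> nlinarith
  set N : ℕ → ℕ := fun j => nStart A * k ^ j with hN
  have hs := nStart_pos hA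
  have hNt : Tendsto N atTop atTop :=
    (tendsto_pow_atTop_atTop_of_one_lt (by omega)).const_mul_atTop' hs
  set p : ℝ := (k : ℝ) ^ w.length with hp
  have hp0 : 0 < p := by positivity
  have key : ∀ᶠ n in atTop, ∀ j, N j = n →
      (occ (pref z n) w : ℝ) ≤ 3 / 2 * n / p ∧ (n : ℝ) / p ≤ 2 * occ (pref z n) w := by
    filter_upwards [eventually_ge_atTop i, (tendsto_ellSeq hA).eventually_ge_atTop (w.length : ℝ),
      (tendsto_epsSeq (A := A)).eventually_le_const (show (0 : ℝ) < 1 / 2 / p by positivity)]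
      with n h1 h2 h3 j hj
    have hG := huv j
    simp only [Gn, Set.mem_iInter] at hG
    have hF := hG j (by simp)
    rw [← hk, show nStart A * k ^ j = n from hj] at hF
    simp only [Fn, Fset, Set.mem_iInter] at hF
    have hE := hF i (by simp; omega) w.length (by
      simp only [Finset.mem_Icc]
      refine ⟨hw, ?_⟩
      have : (w.length : ℤ) ≤ ⌊ellSeq A n⌋ := Int.le_floor.2 (by exact_mod_cast h2)
      omega) w rfl
    simp only [Eset, Set.mem_ofPred_eq, hi, ← hz, ← hk, ← hp] at hE
    rw [abs_lt] at hE
    have h4 : epsSeq A n * n ≤ 1 / 2 / p * n := by gcongr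
    have h5 : 1 / 2 / p * n = 1 / 2 * (n / p) := by ring
    have h6 : 3 / 2 * n / p = 3 / 2 * (n / p) := by ring
    constructor <;> linarith
  obtain ⟨J, hJ⟩ := eventually_atTop.1 (hNt.eventually key)
  filter_upwards [eventually_ge_atTop (N J)] with n hn
  have hex : ∃ j, n < N j := (hNt.eventually_gt_atTop n).exists
  have hj1 := Nat.find_spec hex
  have hj0 : J < Nat.find hex := by
    by_contra! hcon
    have : N (Nat.find hex) ≤ N J := Nat.mul_le_mul_left _ (Nat.pow_le_pow_right (by omega) hcon)
    omega
  obtain ⟨j, hj⟩ : ∃ j, Nat.find hex = j + 1 := ⟨Nat.find hex - 1, by omega⟩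
  have hj2 : N j ≤ n := not_lt.1 (Nat.find_min hex (m := j) (by omega))
  rw [hj] at hj1 hj0
  have hNs : (N (j + 1) : ℝ) = k * N j := by
    simp only [hN]; push_cast; ring
  obtain ⟨a1, -⟩ := hJ (j + 1) (by omega) _ rfl
  obtain ⟨-, a2⟩ := hJ j (by omega) _ rfl
  have b1 : (occ (pref z n) w : ℝ) ≤ occ (pref z (N (j + 1))) w := by
    exact_mod_cast occ_pref_mono z w hj1.le
  have b2 : (occ (pref z (N j)) w : ℝ) ≤ occ (pref z n) w := by
    exact_mod_cast occ_pref_mono z w hj2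
  have c1 : (N j : ℝ) ≤ n := by exact_mod_cast hj2
  have c2 : (n : ℝ) ≤ k * N j := by rw [← hNs]; exact_mod_cast hj1.le
  constructor
  · refine b1.trans (a1.trans ?_)
    rw [hNs]
    gcongr ?_ / _
    nlinarith
  · calc (n : ℝ) / p ≤ k * N j / p := by gcongr
      _ = k * (N j / p) := by ring
      _ ≤ k * (2 * occ (pref z n) w) := by gcongr; linarith
      _ = _ := by ring

/-! ### Weakly normal words are normal -/

/-- The variance of a sum of independent centred variables bounded by `1`. -/
lemma sum_sq_sum_le [Fintype B] (y : B → ℝ) (h0 : ∑ b, y b = 0) (h1 : ∀ b, y b ^ 2 ≤ 1)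
    (m : ℕ) :
    ∑ f : Fin m → B, (∑ j, y (f j)) ^ 2 ≤ (Fintype.card B : ℝ) ^ m * m := by
  induction m with
  | zero => simp
  | succ m ih =>
    rw [← (Fin.consEquiv fun _ => B).sum_comp, Fintype.sum_prod_type]
    simp only [Fin.consEquiv, Equiv.coe_fn_mk, Fin.sum_univ_succ, Fin.cons_zero, Fin.cons_succ]
    have h2 : ∀ b : B, ∑ f : Fin m → B, (y b + ∑ j, y (f j)) ^ 2 =
        (Fintype.card B : ℝ) ^ m * y b ^ 2 + 2 * y b * (∑ f : Fin m → B, ∑ j, y (f j)) +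
          ∑ f : Fin m → B, (∑ j, y (f j)) ^ 2 := by
      intro b
      simp only [add_sq, Finset.sum_add_distrib, Finset.mul_sum]
      simp
    simp only [h2, Finset.sum_add_distrib, ← Finset.sum_mul, ← Finset.mul_sum, h0]
    simp only [mul_zero, zero_mul, add_zero, Finset.sum_const, Finset.card_univ, nsmul_eq_mul]
    have h3 : ∑ b, y b ^ 2 ≤ Fintype.card B := by
      simpa using Finset.sum_le_sum fun b (_ : b ∈ Finset.univ) => h1 b
    have h4 := mul_le_mul_of_nonneg_left h3 (by positivity : 0 ≤ (Fintype.card B : ℝ) ^ m)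
    have h5 := mul_le_mul_of_nonneg_left ih (by positivity : 0 ≤ (Fintype.card B : ℝ))
    push_cast
    calc _ ≤ _ := add_le_add h4 h5
      _ = _ := by ring

/-- Shifting a window over a bounded sequence changes its partial sums by a bounded amount. -/
lemma abs_sum_shift_sub_le (y : ℕ → ℝ) (h : ∀ i, |y i| ≤ 1) (n j : ℕ) :
    |∑ i ∈ Finset.range n, y (i + j) - ∑ i ∈ Finset.range n, y i| ≤ 2 * j := by
  have h1 := Finset.sum_range_add_sub_sum_range y n j
  have h2 : ∑ i ∈ Finset.range n, y (i + j) - ∑ i ∈ Finset.range n, y i =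
      ∑ i ∈ Finset.range j, y (n + i) - ∑ i ∈ Finset.range j, y i := by
    have e1 := Finset.sum_range_add y n j
    have e2 := Finset.sum_range_add y j n
    rw [Nat.add_comm j n] at e2
    simp only [Nat.add_comm j] at e2
    linarith
  have h3 : ∀ g : ℕ → ℝ, (∀ i, |g i| ≤ 1) → |∑ i ∈ Finset.range j, g i| ≤ j := fun g hg => by
    simpa using (Finset.abs_sum_le_sum_abs _ _).trans
      (Finset.sum_le_sum fun i (_ : i ∈ Finset.range j) => hg i)
  rw [h2]
  have := abs_sub (∑ i ∈ Finset.range j, y (n + i)) (∑ i ∈ Finset.range j, y i)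
  have := h3 y h
  have := h3 (fun i => y (n + i)) fun i => h _
  linarith

open Classical in
lemma alocc_pref (z : ℕ → A) {w : List A} (hw : 0 < w.length) (n : ℕ) :
    alocc (pref z (n * w.length)) w =
      {i ∈ Finset.range n | seg z (i * w.length) w.length = w}.card := by
  set ℓ := w.length with hℓ
  have h1 : alocc (pref z (n * ℓ)) w =
      ({i ∈ Finset.range n | seg z (i * ℓ) ℓ = w}.image (· * ℓ)).card := by
    refine Nat.subtype_card _ fun i => ?_
    simp only [Finset.mem_image, Finset.mem_filter, Finset.mem_range, Set.mem_ofPred_eq,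
      length_pref, ← hℓ]
    constructor
    · rintro ⟨i, ⟨h1, h2⟩, rfl⟩
      have : i * ℓ + ℓ ≤ n * ℓ := by
        rw [← Nat.succ_mul]; exact Nat.mul_le_mul_right _ h1
      exact ⟨this, Nat.mul_mod_left _ _, by rw [drop_take_pref z this, h2]⟩
    · rintro ⟨h1, h2, h3⟩
      obtain ⟨a, rfl⟩ := Nat.dvd_of_mod_eq_zero h2
      rw [Nat.mul_comm ℓ a] at h1 h3 ⊢
      refine ⟨a, ⟨?_, by rw [← drop_take_pref z h1, h3]⟩, rfl⟩
      rw [← Nat.succ_mul] at h1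
      exact Nat.le_of_mul_le_mul_right h1 hw
  rw [h1, Finset.card_image_of_injective]
  exact fun a b hab => Nat.eq_of_mul_eq_mul_right hw hab

lemma finite_words [Fintype A] (L : ℕ) : {w : List A | w.length ≤ L}.Finite :=
  List.finite_length_le A L

lemma WeaklyNormal.eventually_occ_le [Fintype A] {K : ℝ} {z : ℕ → A} (h : WeaklyNormal K z)
    (L : ℕ) : ∀ᶠ n : ℕ in atTop, ∀ w : List A, w.length ≤ L →
      (occ (pref z n) w : ℝ) ≤ K * n / (Fintype.card A : ℝ) ^ w.length := by
  have := (eventually_all_finite (finite_words (A := A) L)).2 fun w _ => h w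
  filter_upwards [this] with n hn w hw
  exact (hn w hw).1

/-- The second moment of the number of aligned occurrences in windows of `m` blocks. -/
lemma WeaklyNormal.eventually_sum_sq_le [Fintype A] (hA : 2 ≤ Fintype.card A) {K : ℝ}
    {z : ℕ → A} (h : WeaklyNormal K z) {ℓ : ℕ} (hℓ : 0 < ℓ) (y : (Fin ℓ → A) → ℝ)
    (h0 : ∑ b, y b = 0) (h1 : ∀ b, y b ^ 2 ≤ 1) (m : ℕ) :
    ∀ᶠ n : ℕ in atTop, ∑ i ∈ Finset.range n,
      (∑ j : Fin m, y fun t => z ((i + j) * ℓ + t)) ^ 2 ≤ K * ((n + m : ℕ) * ℓ) * m := by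
  classical
  have ht : Tendsto (fun n => (n + m) * ℓ) atTop atTop :=
    (tendsto_add_atTop_nat m).atTop_mul_const' hℓ
  filter_upwards [ht.eventually (h.eventually_occ_le (m * ℓ))] with n hn
  set k := Fintype.card A with hk
  have hk0 : (0 : ℝ) < k := by exact_mod_cast (by omega : 0 < k)
  set W : ℕ → Fin m → Fin ℓ → A := fun i j t => z ((i + j) * ℓ + t) with hW
  set H : (Fin m → Fin ℓ → A) → ℝ := fun f => (∑ j, y (f j)) ^ 2 with hH
  have hcount : ∀ f : Fin m → Fin ℓ → A,
      ((Finset.range n).filter (fun i => W i = f)).card ≤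
        K * ((n + m : ℕ) * ℓ) / (k : ℝ) ^ (m * ℓ) := by
    intro f
    have hKpos : 0 ≤ K * ((n + m : ℕ) * ℓ) / (k : ℝ) ^ (m * ℓ) := by
      have := hn (seg z 0 (m * ℓ)) (by simp)
      rw [length_seg] at this
      push_cast at this ⊢
      exact le_trans (Nat.cast_nonneg _) this
    rcases ((Finset.range n).filter (fun i => W i = f)).eq_empty_or_nonempty with he | ⟨i₀, hi₀⟩
    · rw [he]; simpa using hKpos
    · simp only [Finset.mem_filter, Finset.mem_range] at hi₀
      have h2 := hn (seg z (i₀ * ℓ) (m * ℓ)) (by simp)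
      rw [length_seg] at h2
      push_cast at h2 ⊢
      refine le_trans ?_ h2
      rw [occ_pref, Nat.cast_le]
      refine Finset.card_le_card_of_injOn (· * ℓ) (fun i hi => ?_)
        fun a _ b _ hab => Nat.eq_of_mul_eq_mul_right hℓ hab
      simp only [Finset.coe_filter, Finset.mem_range, Set.mem_ofPred_eq, length_seg] at hi ⊢
      have h3 : i * ℓ + m * ℓ ≤ (n + m) * ℓ := by
        rw [← Nat.add_mul]; exact Nat.mul_le_mul_right _ (by omega)
      refine ⟨by omega, h3, seg_eq_seg_iff.2 fun j hj => ?_⟩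
      have h4 : W i = W i₀ := hi.2.trans hi₀.2.symm
      have h5 := congrFun (congrFun h4 ⟨j / ℓ, (Nat.div_lt_iff_lt_mul hℓ).2 hj⟩)
        ⟨j % ℓ, Nat.mod_lt _ hℓ⟩
      simp only [hW, Nat.add_mul, Nat.add_assoc, Nat.div_add_mod'] at h5
      exact h5
  calc ∑ i ∈ Finset.range n, (∑ j : Fin m, y fun t => z ((i + j) * ℓ + t)) ^ 2
      = ∑ i ∈ Finset.range n, H (W i) := rfl
    _ = ∑ f, ∑ i ∈ Finset.range n with W i = f, H (W i) :=
        (Finset.sum_fiberwise _ _ _).symm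
    _ = ∑ f, ((Finset.range n).filter (fun i => W i = f)).card * H f := by
        refine Finset.sum_congr rfl fun f _ => ?_
        rw [Finset.sum_congr rfl (g := fun _ => H f), Finset.sum_const, nsmul_eq_mul]
        intro i hi
        rw [(Finset.mem_filter.1 hi).2]
    _ ≤ ∑ f, K * ((n + m : ℕ) * ℓ) / (k : ℝ) ^ (m * ℓ) * H f :=
        Finset.sum_le_sum fun f _ => mul_le_mul_of_nonneg_right (hcount f) (sq_nonneg _)
    _ = K * ((n + m : ℕ) * ℓ) / (k : ℝ) ^ (m * ℓ) * ∑ f, H f := by rw [Finset.mul_sum]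
    _ ≤ K * ((n + m : ℕ) * ℓ) / (k : ℝ) ^ (m * ℓ) * ((k : ℝ) ^ (m * ℓ) * m) := by
        refine mul_le_mul_of_nonneg_left ?_ ((Nat.cast_nonneg _).trans (hcount (W 0)))
        refine (sum_sq_sum_le y h0 h1 m).trans_eq ?_
        rw [Fintype.card_fun, Fintype.card_fin, Nat.cast_pow, ← pow_mul, Nat.mul_comm]
    _ = _ := by field_simp

lemma WeaklyNormal.normal [Fintype A] (hA : 2 ≤ Fintype.card A) {K : ℝ} {z : ℕ → A}
    (h : WeaklyNormal K z) : Normal z := by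
  classical
  intro ℓ hℓ w hw
  set k := Fintype.card A with hk
  have hk1 : (1 : ℝ) ≤ k := by exact_mod_cast (by omega : 1 ≤ k)
  set p : ℝ := (k : ℝ)⁻¹ ^ ℓ with hp
  have hp0 : 0 ≤ p := by positivity
  have hp1 : p ≤ 1 := pow_le_one₀ (by positivity) (inv_le_one_of_one_le₀ hk1)
  set y : (Fin ℓ → A) → ℝ := fun b => (if List.ofFn b = w then 1 else 0) - p with hy
  have hyabs : ∀ b, |y b| ≤ 1 := by
    intro b
    simp only [hy]
    split_ifs <;> rw [abs_le] <;> constructor <;> linarith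
  have hy1 : ∀ b, y b ^ 2 ≤ 1 := fun b => by
    rw [← sq_abs]; exact pow_le_one₀ (abs_nonneg _) (hyabs b)
  have hy0 : ∑ b, y b = 0 := by
    simp only [hy, Finset.sum_sub_distrib, Finset.sum_boole, Finset.sum_const, Finset.card_univ,
      Fintype.card_fun, Fintype.card_fin, nsmul_eq_mul, ← hk]
    have : ({b : Fin ℓ → A | List.ofFn b = w} : Finset _) = {fun i => w.get (i.cast hw.symm)} := by
      ext b
      simp only [Finset.mem_filter, Finset.mem_univ, true_and, Finset.mem_singleton]
      subst hw
      constructor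
      · intro hb
        apply List.ofFn_injective
        rw [hb]
        simp
      · rintro rfl
        simp
    rw [this, Finset.card_singleton, hp]
    push_cast
    rw [← mul_pow, mul_inv_cancel₀ (by positivity), one_pow, sub_self]
  set x : ℕ → ℝ := fun i => y fun t => z (i * ℓ + t) with hx
  have hsum : ∀ n : ℕ, (alocc (pref z (n * ℓ)) w : ℝ) - n * p = ∑ i ∈ Finset.range n, x i := by
    intro n
    have h1 := alocc_pref z (w := w) (by omega) n
    rw [hw] at h1
    rw [h1]
    simp only [hx, hy, Finset.sum_sub_distrib, Finset.sum_boole, Finset.sum_const,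
      Finset.card_range, nsmul_eq_mul, seg, List.ofFn_eq_map]
    congr 3
    refine Finset.filter_congr fun i _ => ?_
    rw [← List.map_coe_finRange_eq_range, List.map_map]
    rfl
  have hK : 0 ≤ K := by
    obtain ⟨n, hn, hn1⟩ := ((h.eventually_occ_le 0).and (eventually_ge_atTop 1)).exists
    have := hn [] le_rfl
    rw [occ_pref_nil] at this
    simp only [List.length_nil, pow_zero, div_one] at this
    by_contra! hneg
    have : (0 : ℝ) ≤ n := Nat.cast_nonneg n
    push_cast at *
    nlinarith
  have hdev : ∀ m : ℕ, 0 < m → ∀ᶠ n : ℕ in atTop,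
      |∑ i ∈ Finset.range n, x i| ≤ n * √(2 * K * ℓ / m) + 2 * m := by
    intro m hm
    filter_upwards [h.eventually_sum_sq_le hA hℓ y hy0 hy1 m, eventually_ge_atTop m] with n hn hmn
    have hmr : (0 : ℝ) < m := by exact_mod_cast hm
    have hmn' : (m : ℝ) ≤ n := by exact_mod_cast hmn
    set h' : ℕ → ℝ := fun i => ∑ j : Fin m, x (i + j) with hh'
    have e1 : (∑ i ∈ Finset.range n, h' i) ^ 2 ≤ n * (K * ((n + m : ℕ) * ℓ) * m) := by
      refine (sq_sum_le_card_mul_sum_sq).trans ?_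
      rw [Finset.card_range]
      exact mul_le_mul_of_nonneg_left hn (Nat.cast_nonneg _)
    have e2 : |∑ i ∈ Finset.range n, h' i| ≤ m * (n * √(2 * K * ℓ / m)) := by
      refine abs_le_of_sq_le_sq (e1.trans ?_) (by positivity)
      rw [mul_pow, mul_pow, Real.sq_sqrt (by positivity)]
      calc n * (K * ((n + m : ℕ) * ℓ) * m) ≤ n * (K * ((n + n) * ℓ) * m) := by
            push_cast; gcongr
        _ = _ := by field_simp; ring
    have e3 : |∑ i ∈ Finset.range n, h' i - m * ∑ i ∈ Finset.range n, x i| ≤ m * (2 * m) := by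
      rw [hh', Finset.sum_comm]
      have : (m : ℝ) * ∑ i ∈ Finset.range n, x i = ∑ _j : Fin m, ∑ i ∈ Finset.range n, x i := by
        simp
      rw [this, ← Finset.sum_sub_distrib]
      refine (Finset.abs_sum_le_sum_abs _ _).trans ?_
      calc _ ≤ ∑ _j : Fin m, (2 * m : ℝ) := Finset.sum_le_sum fun j _ =>
            (abs_sum_shift_sub_le x (fun i => hyabs _) n j).trans (by
              have : (j : ℝ) ≤ m := by exact_mod_cast j.2.le
              linarith)
        _ = _ := by simp
    have e4 : |m * ∑ i ∈ Finset.range n, x i| ≤ m * (n * √(2 * K * ℓ / m) + 2 * m) := by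
      rw [abs_le] at *
      constructor <;> linarith
    rw [abs_mul, Nat.abs_cast] at e4
    exact le_of_mul_le_mul_left e4 hmr
  rw [Metric.tendsto_atTop']
  intro ε hε
  obtain ⟨m, hm0, hm⟩ : ∃ m : ℕ, 0 < m ∧ √(2 * K * ℓ / m) < ε / 2 := by
    have h1 : Tendsto (fun m : ℕ => √(2 * K * ℓ / m)) atTop (𝓝 0) := by
      have h2 := (Real.continuous_sqrt.tendsto _).comp
        (tendsto_const_div_atTop_nhds_zero_nat (2 * K * ℓ))
      rwa [Real.sqrt_zero] at h2
    exact ((eventually_gt_atTop 0).and (h1.eventually_lt_const (half_pos hε))).exists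
  have h2 : ∀ᶠ n : ℕ in atTop, (2 * m : ℝ) < ε / 2 * n :=
    (tendsto_natCast_atTop_atTop.const_mul_atTop (half_pos hε)).eventually_gt_atTop _
  obtain ⟨N, hN⟩ := eventually_atTop.1 ((hdev m hm0).and (h2.and (eventually_gt_atTop 0)))
  refine ⟨N, fun n hn => ?_⟩
  obtain ⟨a1, a2, a3⟩ := hN n hn.le
  have hn0 : (0 : ℝ) < n := by exact_mod_cast a3
  rw [Real.dist_eq, div_sub' hn0.ne', hsum n, abs_div, Nat.abs_cast, div_lt_iff₀ hn0]
  nlinarith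

/-! ### Shufflers as automata reading their output -/

lemma seg_succ (z : ℕ → A) (i L : ℕ) : seg z i (L + 1) = seg z i L ++ [z (i + L)] := by
  simp [seg, List.range_succ]

/-- The shuffler that copies its first input. -/
def Shuffler.fst (A : Type*) : Shuffler A := ⟨1, 0, fun _ => true, fun _ _ => 0⟩

/-- The shuffler that copies its second input. -/
def Shuffler.snd (A : Type*) : Shuffler A := ⟨1, 0, fun _ => false, fun _ _ => 0⟩

/-- The shuffler with the roles of the inputs exchanged. -/
def Shuffler.swap (T : Shuffler A) : Shuffler A := ⟨T.states, T.init, fun q => !T.tyI q, T.δ⟩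

lemma Shuffler.out_fst (u v : ℕ → A) : (Shuffler.fst A).out u v = u := by
  have h : ∀ n, (Shuffler.fst A).cfg u v n = ((Shuffler.fst A).init, n, 0) := by
    intro n
    induction n with
    | zero => rfl
    | succ n ih => simp only [Shuffler.cfg, ih]; rfl
  funext n
  simp only [Shuffler.out, h]
  rfl

lemma Shuffler.out_snd (u v : ℕ → A) : (Shuffler.snd A).out u v = v := by
  have h : ∀ n, (Shuffler.snd A).cfg u v n = ((Shuffler.snd A).init, 0, n) := by
    intro n
    induction n with
    | zero => rfl
    | succ n ih => simp only [Shuffler.cfg, ih]; rfl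
  funext n
  simp only [Shuffler.out, h]
  rfl

lemma Shuffler.out_swap (T : Shuffler A) (u v : ℕ → A) : T.swap.out u v = T.out v u := by
  have h : ∀ n, T.swap.cfg u v n =
      ((T.cfg v u n).1, (T.cfg v u n).2.2, (T.cfg v u n).2.1) := by
    intro n
    induction n with
    | zero => rfl
    | succ n ih =>
      simp only [Shuffler.cfg, ih]
      by_cases hq : T.tyI (T.cfg v u n).1 <;> simp [Shuffler.swap, hq]
  funext n
  simp only [Shuffler.out, h]
  by_cases hq : T.tyI (T.cfg v u n).1 <;> simp [Shuffler.swap, hq]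

lemma Shuffler.cfg_succ_of_tyI (T : Shuffler A) (x y : ℕ → A) {n : ℕ}
    (h : T.tyI (T.cfg x y n).1 = true) :
    T.out x y n = x (T.cfg x y n).2.1 ∧ T.cfg x y (n + 1) =
      (T.δ (T.cfg x y n).1 (x (T.cfg x y n).2.1), (T.cfg x y n).2.1 + 1, (T.cfg x y n).2.2) := by
  simp [Shuffler.out, Shuffler.cfg, h]

lemma Shuffler.cfg_succ_of_not_tyI (T : Shuffler A) (x y : ℕ → A) {n : ℕ}
    (h : T.tyI (T.cfg x y n).1 = false) :
    T.out x y n = y (T.cfg x y n).2.2 ∧ T.cfg x y (n + 1) =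
      (T.δ (T.cfg x y n).1 (y (T.cfg x y n).2.2), (T.cfg x y n).2.1, (T.cfg x y n).2.2 + 1) := by
  simp [Shuffler.out, Shuffler.cfg, h]

lemma Shuffler.cfg_succ_fst (T : Shuffler A) (x y : ℕ → A) (n : ℕ) :
    (T.cfg x y (n + 1)).1 = T.δ (T.cfg x y n).1 (T.out x y n) := by
  rcases h : T.tyI (T.cfg x y n).1 with _ | _
  · rw [(T.cfg_succ_of_not_tyI x y h).1, (T.cfg_succ_of_not_tyI x y h).2]
  · rw [(T.cfg_succ_of_tyI x y h).1, (T.cfg_succ_of_tyI x y h).2]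

lemma Shuffler.foldl_seg (T : Shuffler A) (x y : ℕ → A) (i L : ℕ) :
    (seg (T.out x y) i L).foldl T.δ (T.cfg x y i).1 = (T.cfg x y (i + L)).1 := by
  induction L with
  | zero => rfl
  | succ L ih => rw [seg_succ, List.foldl_append, ih, ← Nat.add_assoc, T.cfg_succ_fst]; rfl

lemma Shuffler.cfg_snd_fst (T : Shuffler A) (x y : ℕ → A) (n : ℕ) :
    (T.cfg x y n).2.1 = {m ∈ Finset.range n | T.tyI (T.cfg x y m).1 = true}.card := by
  induction n with
  | zero => rfl
  | succ n ih =>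
    rw [Finset.range_add_one, Finset.filter_insert]
    rcases h : T.tyI (T.cfg x y n).1 with _ | _
    · rw [(T.cfg_succ_of_not_tyI x y h).2]; simpa using ih
    · rw [(T.cfg_succ_of_tyI x y h).2]; simp [ih]

/-- A word that, read from any state, either visits `P` or leads to a state from which `P` can no
longer be reached. -/
lemma exists_word_visiting {S : Type*} [Fintype S] (δ : S → A → S) (P : S → Prop) :
    ∃ w : List A, ∀ q, (∃ w₁, w₁ <+: w ∧ P (w₁.foldl δ q)) ∨
      ∀ w', ¬ P ((w ++ w').foldl δ q) := by
  classical
  suffices h : ∀ s : Finset S, ∃ w : List A, ∀ q ∈ s, (∃ w₁, w₁ <+: w ∧ P (w₁.foldl δ q)) ∨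
      ∀ w', ¬ P ((w ++ w').foldl δ q) by
    obtain ⟨w, hw⟩ := h Finset.univ
    exact ⟨w, fun q => hw q (Finset.mem_univ q)⟩
  intro s
  induction s using Finset.induction_on with
  | empty => exact ⟨[], by simp⟩
  | insert q s _ ih =>
    obtain ⟨w, hw⟩ := ih
    by_cases h : ∃ w', P ((w ++ w').foldl δ q)
    · obtain ⟨w', h'⟩ := h
      refine ⟨w ++ w', fun r hr => ?_⟩
      rcases Finset.mem_insert.1 hr with rfl | hr
      · exact Or.inl ⟨_, List.prefix_rfl, h'⟩
      · rcases hw r hr with ⟨w₁, h1, h2⟩ | h1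
        · exact Or.inl ⟨w₁, h1.trans (List.prefix_append _ _), h2⟩
        · exact Or.inr fun w'' => by rw [List.append_assoc]; exact h1 _
    · push Not at h
      refine ⟨w, fun r hr => ?_⟩
      rcases Finset.mem_insert.1 hr with rfl | hr
      · exact Or.inr h
      · exact hw r hr

/-- If the output of a shuffler is weakly normal and the first input is read infinitely often,
then it is read with positive frequency. -/
lemma Shuffler.linear_le_of_weaklyNormal [Fintype A] (hA : 2 ≤ Fintype.card A) (T : Shuffler A)
    (x y : ℕ → A) {K : ℝ} (hz : WeaklyNormal K (T.out x y)) (hK : 0 < K)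
    (hinf : ∀ n, ∃ m ≥ n, T.tyI (T.cfg x y m).1 = true) :
    ∃ c : ℝ, 0 < c ∧ ∀ᶠ n : ℕ in atTop, c * n ≤ (T.cfg x y n).2.1 := by
  classical
  obtain ⟨w, hw⟩ := exists_word_visiting T.δ (fun q => T.tyI q = true)
  set z := T.out x y with hzdef
  have hvisit : ∀ i, seg z i w.length = w →
      ∃ m, i ≤ m ∧ m ≤ i + w.length ∧ T.tyI (T.cfg x y m).1 = true := by
    intro i hi
    rcases hw (T.cfg x y i).1 with ⟨w₁, h1, h2⟩ | h1
    · have hle := h1.length_le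
      have h3 : seg z i w₁.length = w₁ := by
        obtain ⟨w₂, h3⟩ := h1
        rw [← h3, List.length_append, seg_add] at hi
        exact (List.append_inj hi (by simp)).1
      rw [← h3, T.foldl_seg] at h2
      exact ⟨i + w₁.length, by omega, by omega, h2⟩
    · obtain ⟨m, hm, hm'⟩ := hinf (i + w.length)
      obtain ⟨d, rfl⟩ := Nat.exists_eq_add_of_le hm
      refine absurd ?_ (h1 (seg z (i + w.length) d))
      rw [← hi, length_seg, ← seg_add, T.foldl_seg, ← Nat.add_assoc]
      exact hm'
  choose! f hf1 hf2 hf3 using hvisit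
  have hocc : ∀ n, occ (pref z n) w ≤ (w.length + 1) * ((T.cfg x y n).2.1 + 1) := by
    intro n
    rw [occ_pref]
    have h1 : {m ∈ Finset.range (n + 1) | T.tyI (T.cfg x y m).1 = true}.card ≤
        (T.cfg x y n).2.1 + 1 := by
      rw [T.cfg_snd_fst, Finset.range_add_one, Finset.filter_insert]
      split_ifs
      · exact Finset.card_insert_le _ _
      · exact Nat.le_succ _
    refine le_trans (Finset.card_le_mul_card_image_of_maps_to (f := f)
      (t := {m ∈ Finset.range (n + 1) | T.tyI (T.cfg x y m).1 = true}) ?_ (w.length + 1) ?_)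
      (Nat.mul_le_mul_left _ h1)
    · intro i hi
      simp only [Finset.mem_filter, Finset.mem_range] at hi ⊢
      have := hf2 i hi.2.2
      exact ⟨by omega, hf3 i hi.2.2⟩
    · intro m _
      calc _ ≤ (Finset.Icc (m - w.length) m).card := by
            refine Finset.card_le_card fun i hi => ?_
            simp only [Finset.mem_filter, Finset.mem_range, Finset.mem_Icc] at hi ⊢
            have := hf1 i hi.1.2.2
            have := hf2 i hi.1.2.2
            omega
        _ ≤ w.length + 1 := by rw [Nat.card_Icc]; omega
  set a : ℝ := (Fintype.card A : ℝ) ^ w.length * (K * (w.length + 1)) with ha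
  have hk0 : (0 : ℝ) < Fintype.card A := by exact_mod_cast (by omega : 0 < Fintype.card A)
  have ha0 : 0 < a := by positivity
  refine ⟨1 / (2 * a), by positivity, ?_⟩
  have hlarge : ∀ᶠ n : ℕ in atTop, 2 * a ≤ n :=
    tendsto_natCast_atTop_atTop.eventually_ge_atTop _
  filter_upwards [hz w, hlarge] with n hn hn2
  have h1 : (occ (pref z n) w : ℝ) ≤ (w.length + 1) * ((T.cfg x y n).2.1 + 1) := by
    exact_mod_cast hocc n
  have h2 : (n : ℝ) ≤ a * ((T.cfg x y n).2.1 + 1) := by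
    have h3 := hn.2.trans (mul_le_mul_of_nonneg_left h1 hK.le)
    rw [div_le_iff₀ (by positivity)] at h3
    calc (n : ℝ) ≤ _ := h3
      _ = _ := by rw [ha]; ring
  rw [div_mul_eq_mul_div, one_mul, div_le_iff₀ (by positivity)]
  nlinarith

/-- The shuffler with an arbitrary finite type of states. -/
noncomputable def Shuffler.ofFintype {S : Type*} [Fintype S] (init : S) (ty : S → Bool)
    (δ : S → A → S) : Shuffler A where
  states := Fintype.card S
  init := Fintype.equivFin S init
  tyI q := ty ((Fintype.equivFin S).symm q)
  δ q a := Fintype.equivFin S (δ ((Fintype.equivFin S).symm q) a)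

section OfFintype

variable {S : Type*} [Fintype S] {init : S} {ty : S → Bool} {δ : S → A → S} {x y : ℕ → A}
  {n : ℕ} {s : S} {i j : ℕ}

lemma Shuffler.ofFintype_step_fst
    (h : (Shuffler.ofFintype init ty δ).cfg x y n = (Fintype.equivFin S s, i, j))
    (hs : ty s = true) :
    (Shuffler.ofFintype init ty δ).out x y n = x i ∧
      (Shuffler.ofFintype init ty δ).cfg x y (n + 1) =
        (Fintype.equivFin S (δ s (x i)), i + 1, j) := by
  have := (Shuffler.ofFintype init ty δ).cfg_succ_of_tyI x y (n := n)
    (by rw [h]; simpa [Shuffler.ofFintype] using hs)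
  rw [h] at this
  simpa [Shuffler.ofFintype] using this

lemma Shuffler.ofFintype_step_snd
    (h : (Shuffler.ofFintype init ty δ).cfg x y n = (Fintype.equivFin S s, i, j))
    (hs : ty s = false) :
    (Shuffler.ofFintype init ty δ).out x y n = y j ∧
      (Shuffler.ofFintype init ty δ).cfg x y (n + 1) =
        (Fintype.equivFin S (δ s (y j)), i, j + 1) := by
  have := (Shuffler.ofFintype init ty δ).cfg_succ_of_not_tyI x y (n := n)
    (by rw [h]; simpa [Shuffler.ofFintype] using hs)
  rw [h] at this
  simpa [Shuffler.ofFintype] using this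

end OfFintype

/-! ### Words read along a sequence of labels -/

/-- The word read by the first `n` labels of `l`. -/
def readWord (l : ℕ → Option A) (n : ℕ) : List A := ((List.range n).map l).reduceOption

/-- The labels `l` read successive symbols of the infinite word `x`. -/
def Reads (l : ℕ → Option A) (x : ℕ → A) : Prop :=
  ∀ n a, l n = some a → a = x (readWord l n).length

lemma readWord_succ (l : ℕ → Option A) (n : ℕ) :
    readWord l (n + 1) = readWord l n ++ (l n).toList := by
  rw [readWord, List.range_succ, List.map_append, List.reduceOption_append]
  cases h : l n <;> simp [readWord, h]

lemma readWord_add (l : ℕ → Option A) (t L : ℕ) :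
    readWord l (t + L) = readWord l t ++ readWord (fun i => l (t + i)) L := by
  simp [readWord, List.range_add, List.reduceOption_append, Function.comp_def]

lemma readWord_congr {l l' : ℕ → Option A} {n : ℕ} (h : ∀ i < n, l i = l' i) :
    readWord l n = readWord l' n := by
  rw [readWord, readWord, List.map_congr_left fun i hi => h i (List.mem_range.1 hi)]

lemma length_readWord_mono (l : ℕ → Option A) {m n : ℕ} (h : m ≤ n) :
    (readWord l m).length ≤ (readWord l n).length := by
  obtain ⟨d, rfl⟩ := Nat.exists_eq_add_of_le h
  rw [readWord_add, List.length_append]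
  exact Nat.le_add_right _ _

lemma length_readWord_le (l : ℕ → Option A) (n : ℕ) : (readWord l n).length ≤ n := by
  simpa [readWord] using List.reduceOption_length_le ((List.range n).map l)

lemma length_readWord_lt {l : ℕ → Option A} {m n : ℕ} (h : m < n) (hs : (l m).isSome) :
    (readWord l m).length < (readWord l n).length := by
  refine lt_of_lt_of_le ?_ (length_readWord_mono l h)
  obtain ⟨a, ha⟩ := Option.isSome_iff_exists.1 hs
  simp [readWord_succ, ha]

lemma forall_readWord_eq_pref_iff {l : ℕ → Option A} {x : ℕ → A} :
    (∀ n, readWord l n = pref x (readWord l n).length) ↔ Reads l x := by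
  constructor
  · intro h n a ha
    have h1 := h (n + 1)
    rw [readWord_succ, ha, List.length_append, Option.toList_some, List.length_singleton,
      pref_add] at h1
    have h2 := (List.append_inj h1 (by simp)).2
    simpa [seg] using h2
  · intro h n
    induction n with
    | zero => simp [readWord, pref]
    | succ n ih =>
      rw [readWord_succ]
      rcases hl : l n with _ | a
      · simpa using ih
      · rw [List.length_append, Option.toList_some, List.length_singleton, pref_add, ← ih]
        simp [seg, h n a hl]

lemma Reads.window_eq_seg {l : ℕ → Option A} {x : ℕ → A} (h : Reads l x) (t L : ℕ) :
    readWord (fun i => l (t + i)) L =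
      seg x (readWord l t).length (readWord (fun i => l (t + i)) L).length := by
  have h1 := forall_readWord_eq_pref_iff.2 h (t + L)
  rw [readWord_add, List.length_append, pref_add] at h1
  exact (List.append_inj h1 (by simp)).2

lemma eq_of_readWord_eq {l l' : ℕ → Option A} {s L : ℕ} (hs : s < L)
    (hr : ∀ r < s, l r = l' r) (h : readWord l L = readWord l' L)
    (hsome : (l s).isSome = (l' s).isSome) : l s = l' s := by
  obtain ⟨d, rfl⟩ := Nat.exists_eq_add_of_lt hs
  rw [show s + d + 1 = (s + 1) + d by omega, readWord_add l, readWord_add l',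
    readWord_succ, readWord_succ, readWord_congr hr, List.append_assoc, List.append_assoc] at h
  have h1 := List.append_cancel_left h
  cases h2 : l s <;> cases h3 : l' s <;> simp_all

/-! ### Splicing sequences -/

/-- The sequence `f` with the `L` terms from `t` on replaced by those from `t'` on. -/
def splice {τ : Type*} (f : ℕ → τ) (t t' L : ℕ) (i : ℕ) : τ :=
  if t ≤ i ∧ i < t + L then f (t' + (i - t)) else f i

section Splice

variable {τ : Type*} (f : ℕ → τ) (t t' L : ℕ)

lemma splice_of_lt {i : ℕ} (h : i < t) : splice f t t' L i = f i :=
  if_neg (by omega)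

lemma splice_add_of_lt {i : ℕ} (h : i < L) : splice f t t' L (t + i) = f (t' + i) := by
  rw [splice, if_pos (by omega), Nat.add_sub_cancel_left]

lemma splice_of_le {i : ℕ} (h : t + L ≤ i) : splice f t t' L i = f i :=
  if_neg (by omega)

lemma comp_splice {σ : Type*} (g : τ → σ) (i : ℕ) :
    g (splice f t t' L i) = splice (fun j => g (f j)) t t' L i := by
  unfold splice
  split_ifs <;> rfl

end Splice

lemma readWord_splice_of_le (l : ℕ → Option A) (t t' L : ℕ) {n : ℕ} (h : n ≤ t) :
    readWord (splice l t t' L) n = readWord l n :=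
  readWord_congr fun _ hi => splice_of_lt _ _ _ _ (by omega)

lemma readWord_splice_add (l : ℕ → Option A) (t t' L : ℕ) {s : ℕ} (h : s ≤ L) :
    readWord (splice l t t' L) (t + s) = readWord l t ++ readWord (fun i => l (t' + i)) s := by
  rw [readWord_add, readWord_splice_of_le _ _ _ _ le_rfl]
  congr 1
  exact readWord_congr fun _ hi => splice_add_of_lt _ _ _ _ (by omega)

lemma length_readWord_splice (l : ℕ → Option A) (t t' L : ℕ)
    (hlen : (readWord (fun i => l (t + i)) L).length = (readWord (fun i => l (t' + i)) L).length)
    {n : ℕ} (h : t + L ≤ n) :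
    (readWord (splice l t t' L) n).length = (readWord l n).length := by
  obtain ⟨d, rfl⟩ := Nat.exists_eq_add_of_le h
  rw [readWord_add, readWord_add l (t + L), readWord_add l t, List.length_append,
    List.length_append, List.length_append, readWord_splice_add _ _ _ _ le_rfl,
    List.length_append, hlen]
  congr 2
  exact readWord_congr fun _ hi => splice_of_le _ _ _ _ (by omega)

lemma Reads.splice {l : ℕ → Option A} {x : ℕ → A} (hl : Reads l x) (t t' L : ℕ)
    (hlen : (readWord (fun i => l (t + i)) L).length = (readWord (fun i => l (t' + i)) L).length) :
    Reads (splice l t t' L) (splice x (readWord l t).length (readWord l t').length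
      (readWord (fun i => l (t + i)) L).length) := by
  intro n a ha
  rcases lt_or_ge n t with h | h
  · rw [splice_of_lt _ _ _ _ h] at ha
    rw [readWord_splice_of_le _ _ _ _ h.le, splice_of_lt]
    · exact hl n a ha
    · exact length_readWord_lt h (by simp [ha])
  obtain ⟨s, rfl⟩ := Nat.exists_eq_add_of_le h
  rcases lt_or_ge s L with h' | h'
  · rw [splice_add_of_lt _ _ _ _ h'] at ha
    rw [readWord_splice_add _ _ _ _ h'.le, List.length_append, splice_add_of_lt]
    · rw [hl _ a ha, readWord_add, List.length_append]
    · rw [hlen]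
      exact length_readWord_lt h' (by simp [ha])
  · rw [splice_of_le _ _ _ _ (by omega)] at ha
    rw [length_readWord_splice _ _ _ _ hlen (by omega), splice_of_le]
    · exact hl _ a ha
    · rw [← List.length_append, ← readWord_add]
      exact length_readWord_mono l (by omega)

/-! ### Runs of compressors -/

section Runs

variable (γ : ℕ → Q × (Option A × Option B) × List D × Q)

lemma c3out_add (t L : ℕ) :
    c3out γ (t + L) = c3out γ t ++ c3out (fun i => γ (t + i)) L := by
  simp [c3out, List.range_add, Function.comp_def]

lemma c3out_congr {γ γ' : ℕ → Q × (Option A × Option B) × List D × Q} {n : ℕ}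
    (h : ∀ i < n, γ i = γ' i) : c3out γ n = c3out γ' n := by
  rw [c3out, c3out, List.map_congr_left fun i hi => by rw [h i (List.mem_range.1 hi)]]

lemma c3out_splice {t t' L : ℕ}
    (ho : c3out (fun i => γ (t + i)) L = c3out (fun i => γ (t' + i)) L) {n : ℕ}
    (h : t + L ≤ n) : c3out (splice γ t t' L) n = c3out γ n := by
  obtain ⟨d, rfl⟩ := Nat.exists_eq_add_of_le h
  have h1 : c3out (splice γ t t' L) t = c3out γ t :=
    c3out_congr fun _ hi => splice_of_lt _ _ _ _ hi
  have h2 : c3out (fun i => splice γ t t' L (t + i)) L = c3out (fun i => γ (t' + i)) L :=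
    c3out_congr fun _ hi => splice_add_of_lt _ _ _ _ hi
  have h3 : c3out (fun i => splice γ t t' L (t + L + i)) d = c3out (fun i => γ (t + L + i)) d :=
    c3out_congr fun _ hi => splice_of_le _ _ _ _ (by omega)
  rw [c3out_add, c3out_add, c3out_add γ, c3out_add γ t, ho, h1, h2, h3]

/-- In a run of a one-to-one compressor, the part of the first input read between two states is
determined by its length, the part of the second input and the output. -/
lemma Comp3.OneToOne.in1_window_eq {C : Comp3 A B D Q} (hC : C.OneToOne)
    {γ : ℕ → Q × (Option A × Option B) × List D × Q} {x : ℕ → A} {y : ℕ → B}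
    (hγ : C.IsAccRunOn γ x y) {t t' L : ℕ} (hq : (γ t).1 = (γ t').1)
    (hq' : (γ (t + L)).1 = (γ (t' + L)).1)
    (h1 : (c3in1 (fun i => γ (t + i)) L).length = (c3in1 (fun i => γ (t' + i)) L).length)
    (h2 : c3in2 (fun i => γ (t + i)) L = c3in2 (fun i => γ (t' + i)) L)
    (ho : c3out (fun i => γ (t + i)) L = c3out (fun i => γ (t' + i)) L) :
    c3in1 (fun i => γ (t + i)) L = c3in1 (fun i => γ (t' + i)) L := by
  obtain ⟨g0, gt, gc, g1, g2, gi1, gi2, go⟩ := id hγ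
  have r1 : Reads (fun i => (γ i).2.1.1) x := forall_readWord_eq_pref_iff.1 g1
  have r2 : Reads (fun i => (γ i).2.1.2) y := forall_readWord_eq_pref_iff.1 g2
  set l1 : ℕ → Option A := fun i => (γ i).2.1.1 with hl1
  set l2 : ℕ → Option B := fun i => (γ i).2.1.2 with hl2
  change (readWord (fun i => l1 (t + i)) L).length = (readWord (fun i => l1 (t' + i)) L).length
    at h1
  change readWord (fun i => l2 (t + i)) L = readWord (fun i => l2 (t' + i)) L at h2
  change readWord (fun i => l1 (t + i)) L = readWord (fun i => l1 (t' + i)) L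
  have s1 := r1.splice t t' L h1
  have s2 := r2.splice t t' L (by rw [h2])
  have w1 := r1.window_eq_seg t L
  have w1' := r1.window_eq_seg t' L
  have w2 := r2.window_eq_seg t L
  have w2' := r2.window_eq_seg t' L
  set x' := splice x (readWord l1 t).length (readWord l1 t').length
    (readWord (fun i => l1 (t + i)) L).length with hx'
  have hy' : splice y (readWord l2 t).length (readWord l2 t').length
      (readWord (fun i => l2 (t + i)) L).length = y := by
    funext i
    rw [splice]
    split_ifs with hi
    · rw [← h2, w2] at w2'
      rw [length_seg] at w2'
      have := seg_eq_seg_iff.1 w2' (i - (readWord l2 t).length) (by omega)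
      rw [← this]
      congr 1
      omega
    · rfl
  rw [hy'] at s2
  have e1 : (fun i => (splice γ t t' L i).2.1.1) = splice l1 t t' L := by
    funext i; exact comp_splice γ t t' L (fun τ => τ.2.1.1) i
  have e2 : (fun i => (splice γ t t' L i).2.1.2) = splice l2 t t' L := by
    funext i; exact comp_splice γ t t' L (fun τ => τ.2.1.2) i
  have hout : ∀ n, t + L ≤ n → c3out (splice γ t t' L) n = c3out γ n :=
    fun n hn => c3out_splice γ ho hn
  have hacc : C.IsAccRunOn (splice γ t t' L) x' y := by
    refine ⟨?_, ?_, ?_, ?_, ?_, ?_, ?_, ?_⟩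
    · rw [← g0, splice]
      split_ifs with h
      · obtain rfl : t = 0 := by omega
        exact hq.symm
      · rfl
    · intro n
      rw [splice]
      split_ifs <;> exact gt _
    · intro n
      rcases lt_trichotomy (n + 1) t with h | h | h
      · rw [splice_of_lt _ _ _ _ (by omega), splice_of_lt _ _ _ _ (by omega), gc]
      · rw [splice_of_lt _ _ _ _ (by omega), gc, h]
        rcases Nat.eq_zero_or_pos L with rfl | hL
        · rw [splice_of_le _ _ _ _ (by omega)]
        · have h' := splice_add_of_lt γ t t' L hL
          rw [Nat.add_zero, Nat.add_zero] at h'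
          rw [hq, h']
      · obtain ⟨s, rfl⟩ := Nat.exists_eq_add_of_le (Nat.lt_succ_iff.1 h)
        rcases lt_trichotomy (s + 1) L with h' | h' | h'
        · rw [splice_add_of_lt _ _ _ _ (by omega), Nat.add_assoc,
            splice_add_of_lt _ _ _ _ (by omega), gc, Nat.add_assoc]
        · rw [splice_add_of_lt _ _ _ _ (by omega), splice_of_le _ _ _ _ (by omega), gc,
            Nat.add_assoc, Nat.add_assoc, h', hq']
        · rw [splice_of_le _ _ _ _ (by omega), splice_of_le _ _ _ _ (by omega), gc]
    · refine forall_readWord_eq_pref_iff.2 ?_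
      rw [e1]
      exact s1
    · refine forall_readWord_eq_pref_iff.2 ?_
      rw [e2]
      exact s2
    · refine gi1.congr' ?_
      filter_upwards [eventually_ge_atTop (t + L)] with n hn
      change _ = (readWord (fun i => (splice γ t t' L i).2.1.1) n).length
      rw [e1, length_readWord_splice _ _ _ _ h1 hn]
      rfl
    · refine gi2.congr' ?_
      filter_upwards [eventually_ge_atTop (t + L)] with n hn
      change _ = (readWord (fun i => (splice γ t t' L i).2.1.2) n).length
      rw [e2, length_readWord_splice _ _ _ _ (by rw [h2]) hn]
      rfl
    · refine go.congr' ?_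
      filter_upwards [eventually_ge_atTop (t + L)] with n hn
      rw [hout n hn]
  have hpre : ∀ ζ : ℕ → Q × (Option A × Option B) × List D × Q, ∀ n,
      c3out ζ n <+: c3out ζ (n + (t + L)) := fun ζ n => by
    rw [c3out_add]; exact List.prefix_append _ _
  have hxx : x = x' := by
    refine hC x x' y _ _ hγ hacc (fun n => ⟨n + (t + L), ?_⟩) (fun n => ⟨n + (t + L), ?_⟩)
    · rw [hout _ (by omega)]; exact hpre γ n
    · rw [← hout _ (by omega)]; exact hpre _ n
  rw [w1, w1', ← h1, seg_eq_seg_iff]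
  intro j hj
  conv_lhs => rw [hxx, hx', splice_add_of_lt _ _ _ _ hj]

/-- A run of a deterministic compressor is determined by its first state and its input. -/
lemma Comp3.TwoDet.window_eq {C : Comp3 A B D Q} (hC : C.TwoDet)
    {γ : ℕ → Q × (Option A × Option B) × List D × Q} (gt : ∀ n, γ n ∈ C.trans)
    (gc : ∀ n, (γ n).2.2.2 = (γ (n + 1)).1) {t t' L : ℕ} (hq : (γ t).1 = (γ t').1)
    (h1 : c3in1 (fun i => γ (t + i)) L = c3in1 (fun i => γ (t' + i)) L)
    (h2 : c3in2 (fun i => γ (t + i)) L = c3in2 (fun i => γ (t' + i)) L) :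
    ∀ s < L, γ (t + s) = γ (t' + s) := by
  intro s
  induction s using Nat.strong_induction_on with
  | _ s ih =>
    intro hs
    have hst : (γ (t + s)).1 = (γ (t' + s)).1 := by
      rcases s with _ | s
      · exact hq
      · rw [← Nat.add_assoc, ← Nat.add_assoc, ← gc, ← gc, ih s (by omega) (by omega)]
    obtain ⟨d1, d2⟩ := hC _ (gt (t + s)) _ (gt (t' + s)) hst
    refine d2 (Prod.ext ?_ ?_)
    · exact eq_of_readWord_eq (l := fun i => (γ (t + i)).2.1.1)
        (l' := fun i => (γ (t' + i)).2.1.1) hs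
        (fun r hr => by rw [ih r hr (by omega)]) h1 (congrArg Prod.fst d1)
    · exact eq_of_readWord_eq (l := fun i => (γ (t + i)).2.1.2)
        (l' := fun i => (γ (t' + i)).2.1.2) hs
        (fun r hr => by rw [ih r hr (by omega)]) h2 (congrArg Prod.snd d1)

end Runs

/-! ### The shuffler following a compressor -/

/-- The target of the transition of `C` from `q` with label `l`, if there is one. -/
noncomputable def Comp3.next (C : Comp3 A B D Q) (q : Q) (l : Option A × Option B) : Option Q :=
  open Classical in
  if h : ∃ τ ∈ C.trans, τ.1 = q ∧ τ.2.1 = l then some h.choose.2.2.2 else none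

lemma Comp3.TwoDet.next_eq {C : Comp3 A B D Q} (hC : C.TwoDet)
    {τ : Q × (Option A × Option B) × List D × Q} (hτ : τ ∈ C.trans) :
    C.next τ.1 τ.2.1 = some τ.2.2.2 := by
  have h : ∃ τ' ∈ C.trans, τ'.1 = τ.1 ∧ τ'.2.1 = τ.2.1 := ⟨τ, hτ, rfl, rfl⟩
  rw [Comp3.next, dif_pos h]
  have h1 := h.choose_spec
  rw [(hC _ h1.1 _ hτ h1.2.1).2 h1.2.2]

lemma Comp3.TwoDet.next_eq_none {C : Comp3 A B D Q} (hC : C.TwoDet)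
    {τ : Q × (Option A × Option B) × List D × Q} (hτ : τ ∈ C.trans) {l : Option A × Option B}
    (hl : lsupp τ.2.1 ≠ lsupp l) : C.next τ.1 l = none := by
  rw [Comp3.next, dif_neg]
  rintro ⟨τ', h1, h2, rfl⟩
  exact hl (hC _ hτ _ h1 h2.symm).1

/-- The state reached from `q` by one transition reading nothing, or `q` itself. -/
noncomputable def Comp3.idle (C : Comp3 A B D Q) (q : Q) : Q :=
  (C.next q (none, none)).getD q

/-- The number of transitions reading nothing that `C` makes from `q` before it halts or reads a
symbol; `0` if it makes infinitely many. -/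
noncomputable def Comp3.idleTime (C : Comp3 A B D Q) (q : Q) : ℕ :=
  open Classical in
  if h : ∃ s, C.next (C.idle^[s] q) (none, none) = none then Nat.find h else 0

/-- The state reached from `q` by the transitions reading nothing. -/
noncomputable def Comp3.settle (C : Comp3 A B D Q) (q : Q) : Q := C.idle^[C.idleTime q] q

lemma Comp3.idleTime_eq {C : Comp3 A B D Q} {q : Q} {s : ℕ}
    (h0 : C.next (C.idle^[s] q) (none, none) = none)
    (h1 : ∀ j < s, C.next (C.idle^[j] q) (none, none) ≠ none) : C.idleTime q = s := by
  classical
  have h : ∃ s, C.next (C.idle^[s] q) (none, none) = none := ⟨s, h0⟩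
  rw [Comp3.idleTime, dif_pos h, Nat.find_eq_iff]
  exact ⟨h0, h1⟩

/-- The transition function of the shuffler following `C`: in a state `(q, some a)` the symbol `a`
of the first input has been read, and a symbol of the second input is awaited. -/
noncomputable def Comp3.shuffleStep (C : Comp3 A A D Q) (p : Q × Option A) (c : A) :
    Q × Option A :=
  match p.2 with
  | none =>
    match C.next p.1 (some c, none) with
    | some q => (C.settle q, none)
    | none =>
      match C.next p.1 (none, some c) with
      | some q => (C.settle q, none)
      | none => (p.1, some c)
  | some a =>
    match C.next p.1 (some a, some c) with
    | some q => (C.settle q, none)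
    | none => p

/-- Whether the shuffler following `C` reads its first input. -/
noncomputable def Comp3.shuffleTy (C : Comp3 A A D Q) (p : Q × Option A) : Bool :=
  open Classical in
  match p.2 with
  | none => decide (∃ τ ∈ C.trans, τ.1 = p.1 ∧ τ.2.1.1.isSome)
  | some _ => false

/-- The shuffler reading its inputs in the same order as `C`. -/
noncomputable def Comp3.shuffler [Fintype A] [Fintype Q] (C : Comp3 A A D Q) : Shuffler A :=
  Shuffler.ofFintype (C.settle C.init, none) C.shuffleTy C.shuffleStep

/-- The symbols read by a transition, from the first and then from the second input. -/
def labelWord (τ : Q × (Option A × Option A) × List D × Q) : List A :=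
  τ.2.1.1.toList ++ τ.2.1.2.toList

/-- The total number of symbols read by the first `n` transitions. -/
def readLength (γ : ℕ → Q × (Option A × Option B) × List D × Q) (n : ℕ) : ℕ :=
  (c3in1 γ n).length + (c3in2 γ n).length

lemma c3in1_succ (γ : ℕ → Q × (Option A × Option B) × List D × Q) (n : ℕ) :
    c3in1 γ (n + 1) = c3in1 γ n ++ (γ n).2.1.1.toList :=
  readWord_succ (fun i => (γ i).2.1.1) n

lemma c3in2_succ (γ : ℕ → Q × (Option A × Option B) × List D × Q) (n : ℕ) :
    c3in2 γ (n + 1) = c3in2 γ n ++ (γ n).2.1.2.toList :=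
  readWord_succ (fun i => (γ i).2.1.2) n

lemma readLength_succ (γ : ℕ → Q × (Option A × Option A) × List D × Q) (n : ℕ) :
    readLength γ (n + 1) = readLength γ n + (labelWord (γ n)).length := by
  simp only [readLength, c3in1_succ, c3in2_succ, labelWord, List.length_append]
  omega

lemma readLength_mono (γ : ℕ → Q × (Option A × Option A) × List D × Q) :
    Monotone (readLength γ) :=
  monotone_nat_of_le_succ fun n => by rw [readLength_succ]; omega

/-- A run of `C` reading infinitely many symbols of its first input. -/
structure Comp3.IsRun (C : Comp3 A B D Q) (γ : ℕ → Q × (Option A × Option B) × List D × Q)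
    (x : ℕ → A) (y : ℕ → B) : Prop where
  init : (γ 0).1 = C.init
  mem : ∀ n, γ n ∈ C.trans
  chain : ∀ n, (γ n).2.2.2 = (γ (n + 1)).1
  reads1 : Reads (fun i => (γ i).2.1.1) x
  reads2 : Reads (fun i => (γ i).2.1.2) y
  tendsto1 : Tendsto (fun n => (c3in1 γ n).length) atTop atTop

lemma Comp3.IsAccRunOn.isRun {C : Comp3 A B D Q}
    {γ : ℕ → Q × (Option A × Option B) × List D × Q} {x : ℕ → A} {y : ℕ → B}
    (h : C.IsAccRunOn γ x y) : C.IsRun γ x y :=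
  ⟨h.1, h.2.1, h.2.2.1, forall_readWord_eq_pref_iff.1 h.2.2.2.1,
    forall_readWord_eq_pref_iff.1 h.2.2.2.2.1, h.2.2.2.2.2.1⟩

namespace Comp3.IsRun

variable {C : Comp3 A A D Q} {γ : ℕ → Q × (Option A × Option A) × List D × Q} {x y : ℕ → A}

/-- Every state of the run is followed by finitely many transitions reading nothing. -/
lemma exists_idle (hC : C.TwoDet) (h : C.IsRun γ x y) (n : ℕ) :
    (γ (n + C.idleTime (γ n).1)).2.1 ≠ (none, none) ∧
      (γ (n + C.idleTime (γ n).1)).1 = C.settle (γ n).1 := by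
  classical
  have hex : ∃ s, (γ (n + s)).2.1 ≠ (none, none) := by
    by_contra! hcon
    have h1 : ∀ s, (c3in1 γ (n + s)).length = (c3in1 γ n).length := by
      intro s
      induction s with
      | zero => rfl
      | succ s ih => rw [← Nat.add_assoc, c3in1_succ, hcon]; simpa using ih
    obtain ⟨N, hN⟩ := (h.tendsto1.eventually_gt_atTop (c3in1 γ n).length).exists_forall_of_atTop
    have := hN (n + N) (by omega)
    rw [h1] at this
    exact lt_irrefl _ this
  have hmin := fun j (hj : j < Nat.find hex) => not_not.1 (Nat.find_min hex hj)
  have hspec := Nat.find_spec hex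
  set s := Nat.find hex with hs
  have hnext : ∀ j < s, C.next (γ (n + j)).1 (none, none) = some (γ (n + j + 1)).1 := by
    intro j hj
    rw [← h.chain, ← hmin j hj]
    exact hC.next_eq (h.mem _)
  have hiter : ∀ j ≤ s, C.idle^[j] (γ n).1 = (γ (n + j)).1 := by
    intro j
    induction j with
    | zero => intro _; rfl
    | succ j ih =>
      intro hj
      rw [Function.iterate_succ_apply', ih (by omega), Comp3.idle, hnext j (by omega)]
      rfl
  have htime : C.idleTime (γ n).1 = s := by
    refine Comp3.idleTime_eq ?_ fun j hj => ?_
    · rw [hiter s le_rfl]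
      refine hC.next_eq_none (h.mem _) fun hl => hspec ?_
      simp only [lsupp, Option.isSome_none, Prod.mk.injEq, Option.isSome_eq_false_iff,
        Option.isNone_iff_eq_none] at hl
      exact Prod.ext hl.1 hl.2
    · rw [hiter j hj.le, hnext j hj]
      simp
  rw [Comp3.settle, htime, hiter s le_rfl]
  exact ⟨hspec, rfl⟩

lemma settle_eq_self (hC : C.TwoDet) (h : C.IsRun γ x y) {n : ℕ}
    (hn : (γ n).2.1 ≠ (none, none)) : C.settle (γ n).1 = (γ n).1 := by
  have h0 : C.idleTime (γ n).1 = 0 := by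
    refine Comp3.idleTime_eq ?_ (by simp)
    refine hC.next_eq_none (h.mem n) fun hl => hn ?_
    simp only [lsupp, Option.isSome_none, Prod.mk.injEq, Option.isSome_eq_false_iff,
      Option.isNone_iff_eq_none] at hl
    exact Prod.ext hl.1 hl.2
  rw [Comp3.settle, h0]
  rfl

lemma settle_succ (hC : C.TwoDet) (h : C.IsRun γ x y) {n : ℕ}
    (hn : (γ n).2.1 = (none, none)) : C.settle (γ (n + 1)).1 = C.settle (γ n).1 := by
  have hidle : C.idle (γ n).1 = (γ (n + 1)).1 := by
    rw [Comp3.idle, ← hn, hC.next_eq (h.mem n), ← h.chain]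
    rfl
  obtain ⟨h1, h2⟩ := h.exists_idle hC n
  obtain ⟨s, hs⟩ : ∃ s, C.idleTime (γ n).1 = s + 1 := by
    refine Nat.exists_eq_succ_of_ne_zero fun h0 => ?_
    rw [h0] at h1
    exact h1 hn
  have hex : ∃ s, C.next (C.idle^[s] (γ n).1) (none, none) = none := by
    by_contra hcon
    rw [Comp3.idleTime, dif_neg hcon] at hs
    omega
  classical
  have hfind : Nat.find hex = s + 1 := by
    rw [← hs, Comp3.idleTime, dif_pos hex]
  have hs' : C.idleTime (γ (n + 1)).1 = s := by
    rw [← hidle]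
    refine Comp3.idleTime_eq ?_ fun j hj => ?_
    · rw [← Function.iterate_succ_apply, ← Nat.succ_eq_add_one] at *
      have := Nat.find_spec hex
      rwa [hfind] at this
    · rw [← Function.iterate_succ_apply]
      exact Nat.find_min hex (by omega)
  rw [Comp3.settle, Comp3.settle, hs, hs', Function.iterate_succ_apply, hidle]

/-- Within a bounded number of transitions, a symbol is read. -/
lemma exists_idle_bound [Fintype Q] (hC : C.TwoDet) (h : C.IsRun γ x y) :
    ∃ E : ℕ, ∀ n, readLength γ n < readLength γ (n + E) := by
  refine ⟨∑ q, C.idleTime q + 1, fun n => ?_⟩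
  have h1 := (h.exists_idle hC n).1
  have h2 : C.idleTime (γ n).1 ≤ ∑ q, C.idleTime q :=
    Finset.single_le_sum (f := C.idleTime) (fun _ _ => Nat.zero_le _) (Finset.mem_univ _)
  set s := C.idleTime (γ n).1
  have h3 : 0 < (labelWord (γ (n + s))).length := by
    by_contra! hcon
    refine h1 ?_
    simp only [labelWord, Nat.le_zero, List.length_eq_zero_iff, List.append_eq_nil_iff,
      Option.toList_eq_nil_iff] at hcon
    exact Prod.ext hcon.1 hcon.2
  calc readLength γ n ≤ readLength γ (n + s) := readLength_mono γ (by omega)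
    _ < readLength γ (n + s + 1) := by rw [readLength_succ]; omega
    _ ≤ _ := readLength_mono γ (by omega)

variable [Fintype A] [Fintype Q]

/-- One transition of the run is simulated by the shuffler following `C`. -/
lemma shuffler_step (hC : C.TwoDet) (h : C.IsRun γ x y) {n : ℕ}
    (ih : C.shuffler.cfg x y (readLength γ n) =
      (Fintype.equivFin _ (C.settle (γ n).1, none), (c3in1 γ n).length, (c3in2 γ n).length)) :
    C.shuffler.cfg x y (readLength γ (n + 1)) =
      (Fintype.equivFin _ (C.settle (γ (n + 1)).1, none), (c3in1 γ (n + 1)).length,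
        (c3in2 γ (n + 1)).length) ∧
    seg (C.shuffler.out x y) (readLength γ n) (labelWord (γ n)).length = labelWord (γ n) := by
  have hmem := h.mem n
  have hnx := hC.next_eq hmem
  have hnone := fun l => hC.next_eq_none hmem (l := l)
  rw [readLength_succ, c3in1_succ, c3in2_succ]
  rw [h.chain] at hnx
  rcases hl : (γ n).2.1 with ⟨_ | a, _ | b⟩
  · have e := h.settle_succ hC hl
    simp [labelWord, hl, ih, e, seg]
    rfl
  · have hs : C.settle (γ n).1 = (γ n).1 := h.settle_eq_self hC (by simp [hl])
    have hb : b = y (c3in2 γ n).length := h.reads2 n b (by simp [hl])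
    rw [hl] at hnx hnone
    rw [hs] at ih
    have hty : C.shuffleTy ((γ n).1, none) = false := by
      simp only [Comp3.shuffleTy, decide_eq_false_iff_not]
      rintro ⟨τ, h1, h2, h3⟩
      have h4 := (hC _ h1 _ hmem h2).1
      rw [hl] at h4
      simp only [lsupp, Prod.mk.injEq] at h4
      simp [h3] at h4
    have hst := Shuffler.ofFintype_step_snd ih hty
    rw [← hb] at hst
    have hδ : C.shuffleStep ((γ n).1, none) b = (C.settle (γ (n + 1)).1, none) := by
      simp only [Comp3.shuffleStep, hnone (some b, none) (by simp [lsupp]), hnx]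
    rw [hδ] at hst
    refine ⟨?_, ?_⟩
    · simpa [labelWord, hl, Comp3.shuffler] using hst.2
    · simpa [labelWord, hl, Comp3.shuffler, seg] using hst.1
  · have hs : C.settle (γ n).1 = (γ n).1 := h.settle_eq_self hC (by simp [hl])
    have ha : a = x (c3in1 γ n).length := h.reads1 n a (by simp [hl])
    rw [hs] at ih
    have hty : C.shuffleTy ((γ n).1, none) = true := by
      simp only [Comp3.shuffleTy, decide_eq_true_eq]
      exact ⟨_, hmem, rfl, by simp [hl]⟩
    rw [hl] at hnx hnone
    have hst := Shuffler.ofFintype_step_fst ih hty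
    rw [← ha] at hst
    have hδ : C.shuffleStep ((γ n).1, none) a = (C.settle (γ (n + 1)).1, none) := by
      simp only [Comp3.shuffleStep, hnx]
    rw [hδ] at hst
    refine ⟨?_, ?_⟩
    · simpa [labelWord, hl, Comp3.shuffler] using hst.2
    · simpa [labelWord, hl, Comp3.shuffler, seg] using hst.1
  · have hs : C.settle (γ n).1 = (γ n).1 := h.settle_eq_self hC (by simp [hl])
    have ha : a = x (c3in1 γ n).length := h.reads1 n a (by simp [hl])
    have hb : b = y (c3in2 γ n).length := h.reads2 n b (by simp [hl])
    rw [hs] at ih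
    have hty : C.shuffleTy ((γ n).1, none) = true := by
      simp only [Comp3.shuffleTy, decide_eq_true_eq]
      exact ⟨_, hmem, rfl, by simp [hl]⟩
    rw [hl] at hnx hnone
    have hst := Shuffler.ofFintype_step_fst ih hty
    rw [← ha] at hst
    have hδ : C.shuffleStep ((γ n).1, none) a = ((γ n).1, some a) := by
      simp only [Comp3.shuffleStep, hnone (some a, none) (by simp [lsupp]),
        hnone (none, some a) (by simp [lsupp])]
    rw [hδ] at hst
    have hst' := Shuffler.ofFintype_step_snd hst.2 (by simp [Comp3.shuffleTy])
    rw [← hb] at hst'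
    have hδ' : C.shuffleStep ((γ n).1, some a) b = (C.settle (γ (n + 1)).1, none) := by
      simp only [Comp3.shuffleStep, hnx]
    rw [hδ'] at hst'
    refine ⟨?_, ?_⟩
    · simpa [labelWord, hl, Comp3.shuffler] using hst'.2
    · have e1 := hst.1
      have e2 := hst'.1
      simp [labelWord, hl, Comp3.shuffler, seg, List.range_succ, e1, e2]

lemma shuffler_cfg (hC : C.TwoDet) (h : C.IsRun γ x y) (n : ℕ) :
    C.shuffler.cfg x y (readLength γ n) =
      (Fintype.equivFin _ (C.settle (γ n).1, none), (c3in1 γ n).length,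
        (c3in2 γ n).length) := by
  induction n with
  | zero => rw [h.init]; rfl
  | succ n ih => exact (h.shuffler_step hC ih).1

/-- The word output by the shuffler along a window of the run. -/
lemma seg_shuffler_out (hC : C.TwoDet) (h : C.IsRun γ x y) (t L : ℕ) :
    seg (C.shuffler.out x y) (readLength γ t) (readLength γ (t + L) - readLength γ t) =
      ((List.range L).map fun i => labelWord (γ (t + i))).flatten := by
  induction L with
  | zero => simp [seg]
  | succ L ih =>
    have h1 := readLength_mono γ (Nat.le_add_right t L)
    have h2 := (h.shuffler_step hC (h.shuffler_cfg hC (t + L))).2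
    have h3 : readLength γ (t + (L + 1)) - readLength γ t =
        (readLength γ (t + L) - readLength γ t) + (labelWord (γ (t + L))).length := by
      rw [← Nat.add_assoc, readLength_succ]
      omega
    rw [h3, seg_add, ih, Nat.add_sub_cancel' h1, h2]
    simp [List.range_succ]

end Comp3.IsRun

/-! ### Counting windows of a run -/

/-- Kraft's inequality for words of length at most `m`. -/
lemma sum_inv_card_pow_length_le [Fintype D] (s : Finset (List D)) {m : ℕ}
    (hs : ∀ o ∈ s, o.length ≤ m) :
    ∑ o ∈ s, ((Fintype.card D : ℝ)⁻¹) ^ o.length ≤ m + 1 := by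
  classical
  rw [← Finset.sum_fiberwise_of_maps_to (t := Finset.range (m + 1)) (g := List.length)
    fun o ho => Finset.mem_range.2 (Nat.lt_succ_of_le (hs o ho))]
  calc ∑ j ∈ Finset.range (m + 1), ∑ o ∈ s with o.length = j,
        ((Fintype.card D : ℝ)⁻¹) ^ o.length
      ≤ ∑ _j ∈ Finset.range (m + 1), (1 : ℝ) := by
        refine Finset.sum_le_sum fun j _ => ?_
        have h1 : ({o ∈ s | o.length = j} : Finset (List D)).card ≤ Fintype.card D ^ j := by
          have h2 : Fintype.card (Fin j → D) = Fintype.card D ^ j := by simp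
          rw [← h2, ← Finset.card_univ]
          refine (Finset.card_le_card (t := Finset.univ.image
            (List.ofFn : (Fin j → D) → List D)) fun o ho => ?_).trans Finset.card_image_le
          obtain rfl := (Finset.mem_filter.1 ho).2
          exact Finset.mem_image.2 ⟨o.get, Finset.mem_univ _, List.ofFn_get o⟩
        rw [Finset.sum_congr rfl fun o ho => by rw [(Finset.mem_filter.1 ho).2],
          Finset.sum_const, nsmul_eq_mul]
        calc _ ≤ (Fintype.card D : ℝ) ^ j * ((Fintype.card D : ℝ)⁻¹) ^ j := by
              gcongr
              exact_mod_cast h1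
          _ ≤ 1 := by
              rw [← mul_pow]
              exact pow_le_one₀ (by positivity) (mul_inv_le_one)
    _ = m + 1 := by simp

lemma sum_mul_le_of_injOn {ι α β κ : Type*} (P : Finset ι) (f : ι → α) (g : ι → β) (h : ι → κ)
    (hinj : Set.InjOn (fun p => (f p, g p, h p)) P) (S : Finset α) (hS : ∀ p ∈ P, f p ∈ S)
    (φ : β → ℝ) (ψ : κ → ℝ) (hφ : ∀ b, 0 ≤ φ b) (hψ : ∀ b, 0 ≤ ψ b) {c₁ c₂ : ℝ}
    (h₁ : ∀ T : Finset β, (∀ b ∈ T, ∃ p ∈ P, g p = b) → ∑ b ∈ T, φ b ≤ c₁)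
    (h₂ : ∀ T : Finset κ, (∀ b ∈ T, ∃ p ∈ P, h p = b) → ∑ b ∈ T, ψ b ≤ c₂) :
    ∑ p ∈ P, φ (g p) * ψ (h p) ≤ S.card * (c₁ * c₂) := by
  classical
  calc ∑ p ∈ P, φ (g p) * ψ (h p)
      = ∑ r ∈ P.image (fun p => (f p, g p, h p)), φ r.2.1 * ψ r.2.2 :=
        (Finset.sum_image (f := fun r : α × β × κ => φ r.2.1 * ψ r.2.2) hinj).symm
    _ ≤ ∑ r ∈ S ×ˢ P.image g ×ˢ P.image h, φ r.2.1 * ψ r.2.2 := by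
        refine Finset.sum_le_sum_of_subset_of_nonneg ?_ fun r _ _ => mul_nonneg (hφ _) (hψ _)
        intro r hr
        obtain ⟨p, hp, rfl⟩ := Finset.mem_image.1 hr
        simp only [Finset.mem_product]
        exact ⟨hS p hp, Finset.mem_image_of_mem _ hp, Finset.mem_image_of_mem _ hp⟩
    _ = S.card * ((∑ b ∈ P.image g, φ b) * ∑ b ∈ P.image h, ψ b) := by
        simp only [Finset.sum_product, Finset.sum_mul_sum, Finset.sum_const, nsmul_eq_mul]
    _ ≤ S.card * (c₁ * c₂) := by
        have e₁ := h₁ (P.image g) fun b hb => Finset.mem_image.1 hb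
        have e₂ := h₂ (P.image h) fun b hb => Finset.mem_image.1 hb
        have n₁ : 0 ≤ ∑ b ∈ P.image g, φ b := Finset.sum_nonneg fun b _ => hφ b
        have n₂ : 0 ≤ ∑ b ∈ P.image h, ψ b := Finset.sum_nonneg fun b _ => hψ b
        gcongr
        linarith

/-- The transitions of a deterministic compressor output words of bounded length. -/
lemma Comp3.TwoDet.exists_length_le [Finite A] [Finite B] [Finite Q] {C : Comp3 A B D Q}
    (hC : C.TwoDet) : ∃ M : ℕ, ∀ τ ∈ C.trans, τ.2.2.1.length ≤ M := by
  have hfin : C.trans.Finite := by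
    refine Set.Finite.of_finite_image (f := fun τ => (τ.1, τ.2.1)) (Set.toFinite _) ?_
    intro τ hτ τ' hτ' h
    simp only [Prod.mk.injEq] at h
    exact (hC τ hτ τ' hτ' h.1).2 h.2
  obtain ⟨M, hM⟩ := (hfin.image fun τ => τ.2.2.1.length).bddAbove
  exact ⟨M, fun τ hτ => hM (Set.mem_image_of_mem _ hτ)⟩

lemma length_c3out_le {γ : ℕ → Q × (Option A × Option B) × List D × Q} {M : ℕ}
    (h : ∀ n, (γ n).2.2.1.length ≤ M) (n : ℕ) : (c3out γ n).length ≤ n * M := by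
  induction n with
  | zero => simp [c3out]
  | succ n ih =>
    rw [c3out_add, List.length_append, Nat.succ_mul]
    have := h n
    simp only [c3out, List.range_one, List.map_cons, Nat.add_zero, List.map_nil,
      List.flatten_singleton] at *
    omega

lemma length_labelWord_flatten (γ : ℕ → Q × (Option A × Option A) × List D × Q) (L : ℕ) :
    ((List.range L).map fun i => labelWord (γ i)).flatten.length = readLength γ L := by
  induction L with
  | zero => rfl
  | succ L ih => simp [List.range_succ, readLength_succ, ← ih]

lemma card_filter_readLength_le {γ : ℕ → Q × (Option A × Option A) × List D × Q} {E : ℕ}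
    (hE : ∀ n, readLength γ n < readLength γ (n + E)) (s : Finset ℕ) (a : ℕ) :
    ({t ∈ s | readLength γ t = a} : Finset ℕ).card ≤ E := by
  rcases ({t ∈ s | readLength γ t = a} : Finset ℕ).eq_empty_or_nonempty with h | h
  · simp [h]
  set F := ({t ∈ s | readLength γ t = a} : Finset ℕ)
  have hmem : ∀ t ∈ F, readLength γ t = a := fun t ht => (Finset.mem_filter.1 ht).2
  calc F.card ≤ (Finset.Ico (F.min' h) (F.min' h + E)).card := by
        refine Finset.card_le_card fun t ht => Finset.mem_Ico.2 ⟨F.min'_le t ht, ?_⟩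
        by_contra! hcon
        have h1 := readLength_mono γ hcon
        have h2 := hE (F.min' h)
        rw [hmem t ht] at h1
        rw [hmem _ (F.min'_mem h)] at h2
        omega
    _ = E := by simp

/-- The transitions of `γ` from `t` to `t + L`. -/
def window (γ : ℕ → Q × (Option A × Option B) × List D × Q) (L t : ℕ) :
    List (Q × (Option A × Option B) × List D × Q) :=
  (List.range L).map fun i => γ (t + i)

/-- The ratio of the number of words as long as the first input and the output of a window. -/
noncomputable def weight [Fintype A] [Fintype D]
    (p : List (Q × (Option A × Option B) × List D × Q)) : ℝ :=
  (Fintype.card A : ℝ) ^ (p.map fun τ => τ.2.1.1).reduceOption.length *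
    ((Fintype.card D : ℝ)⁻¹) ^ (p.map fun τ => τ.2.2.1).flatten.length

lemma weight_window [Fintype A] [Fintype D]
    (γ : ℕ → Q × (Option A × Option B) × List D × Q) (L t : ℕ) :
    weight (window γ L t) = (Fintype.card A : ℝ) ^ (c3in1 (fun i => γ (t + i)) L).length *
      ((Fintype.card D : ℝ)⁻¹) ^ (c3out (fun i => γ (t + i)) L).length := by
  simp [weight, window, c3in1, c3out, Function.comp_def]

/-- The number of occurrences of a window in a run is bounded by that of the word it reads. -/
lemma Comp3.IsRun.card_window_le [Fintype A] [Fintype Q]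
    [DecidableEq (List (Q × (Option A × Option A) × List D × Q))] {C : Comp3 A A D Q}
    {γ : ℕ → Q × (Option A × Option A) × List D × Q} {x y : ℕ → A} (h : C.IsRun γ x y)
    (hC : C.TwoDet) {E : ℕ} (hE : ∀ n, readLength γ n < readLength γ (n + E))
    (L n : ℕ) (p : List (Q × (Option A × Option A) × List D × Q)) :
    ({t ∈ Finset.range n | window γ L t = p} : Finset ℕ).card ≤
      E * occ (pref (C.shuffler.out x y) (2 * (n + L))) (p.map labelWord).flatten := by
  classical
  refine (Finset.card_le_mul_card_image (f := readLength γ) _ E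
    fun a _ => card_filter_readLength_le hE _ a).trans (Nat.mul_le_mul_left _ ?_)
  rw [occ_pref]
  refine Finset.card_le_card fun i hi => ?_
  obtain ⟨t, ht, rfl⟩ := Finset.mem_image.1 hi
  obtain ⟨htn, rfl⟩ := Finset.mem_filter.1 ht
  have hseg := h.seg_shuffler_out hC t L
  have hw : ((window γ L t).map labelWord).flatten =
      ((List.range L).map fun i => labelWord (γ (t + i))).flatten := by
    simp [window, Function.comp_def]
  have hlen := congrArg List.length hseg
  rw [length_seg] at hlen
  have hle : readLength γ (t + L) ≤ 2 * (n + L) := by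
    have h1 := length_readWord_le (fun i => (γ i).2.1.1) (t + L)
    have h2 := length_readWord_le (fun i => (γ i).2.1.2) (t + L)
    have h3 := Finset.mem_range.1 htn
    simp only [readLength, c3in1, c3in2, readWord] at *
    omega
  have hmono := readLength_mono γ (Nat.le_add_right t L)
  simp only [Finset.mem_filter, Finset.mem_range]
  rw [hw, ← hlen, hseg]
  refine ⟨by omega, by omega, rfl⟩

/-- The transitions of a window are determined by the first and last states, the length of the
first input, the second input and the output. -/
lemma Comp3.OneToOne.injOn_window {C : Comp3 A B D Q} (hC : C.TwoDet) (hC' : C.OneToOne)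
    {γ : ℕ → Q × (Option A × Option B) × List D × Q} {x : ℕ → A} {y : ℕ → B}
    (hγ : C.IsAccRunOn γ x y) (L : ℕ) :
    Set.InjOn (fun p : List (Q × (Option A × Option B) × List D × Q) =>
      ((p.head?.map fun τ => τ.1, p.getLast?.map fun τ => τ.2.2.2,
          (p.map fun τ => τ.2.1.1).reduceOption.length),
        (p.map fun τ => τ.2.1.2).reduceOption, (p.map fun τ => τ.2.2.1).flatten))
      (Set.range (window γ L)) := by
  rintro _ ⟨t, rfl⟩ _ ⟨t', rfl⟩ heq
  rcases L with _ | L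
  · rfl
  simp only [Prod.mk.injEq] at heq
  obtain ⟨⟨e1, e2, e3⟩, e4, e5⟩ := heq
  have hq : (γ t).1 = (γ t').1 := by
    simpa [window, List.range_succ_eq_map] using e1
  have hq' : (γ (t + (L + 1))).1 = (γ (t' + (L + 1))).1 := by
    rw [← Nat.add_assoc, ← Nat.add_assoc, ← hγ.2.2.1, ← hγ.2.2.1]
    simpa [window, List.range_succ] using e2
  have e3' : (c3in1 (fun i => γ (t + i)) (L + 1)).length =
      (c3in1 (fun i => γ (t' + i)) (L + 1)).length := by
    simpa only [window, List.map_map, Function.comp_def, c3in1] using e3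
  have e4' : c3in2 (fun i => γ (t + i)) (L + 1) = c3in2 (fun i => γ (t' + i)) (L + 1) := by
    simpa only [window, List.map_map, Function.comp_def, c3in2] using e4
  have e5' : c3out (fun i => γ (t + i)) (L + 1) = c3out (fun i => γ (t' + i)) (L + 1) := by
    simpa only [window, List.map_map, Function.comp_def, c3out] using e5
  have h1 := hC'.in1_window_eq hγ hq hq' e3' e4' e5'
  exact List.map_congr_left fun s hs =>
    hC.window_eq hγ.2.1 hγ.2.2.1 hq h1 e4' s (List.mem_range.1 hs)

/-- The average weight of the windows of length `L` is bounded by a polynomial in `L`. -/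
lemma Comp3.IsAccRunOn.exists_sum_weight_le [Fintype A] [Nonempty A] [Fintype D] [Fintype Q]
    {C : Comp3 A A D Q} (hC : C.TwoDet) (hC' : C.OneToOne)
    {γ : ℕ → Q × (Option A × Option A) × List D × Q} {x y : ℕ → A}
    (hγ : C.IsAccRunOn γ x y) {K : ℝ} (hK : 0 < K)
    (hz : WeaklyNormal K (C.shuffler.out x y)) :
    ∃ c : ℝ, 0 < c ∧ ∀ L : ℕ, ∀ᶠ n : ℕ in atTop,
      ∑ t ∈ Finset.range n, weight (window γ L t) ≤ c * (L + 1) ^ 3 * n := by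
  classical
  obtain ⟨E, hE⟩ := hγ.isRun.exists_idle_bound hC
  obtain ⟨M, hM⟩ := hC.exists_length_le
  have hM' : ∀ t n, (γ (t + n)).2.2.1.length ≤ M := fun t n => hM _ (hγ.2.1 _)
  have hE0 : 0 < E := by
    refine Nat.pos_of_ne_zero fun h0 => ?_
    have := hE 0
    simp [h0] at this
  have hk : (0 : ℝ) < Fintype.card A := by exact_mod_cast Fintype.card_pos
  refine ⟨E * (4 * K) * (((Fintype.card Q : ℝ) + 1) ^ 2 * (M + 1)), by positivity, fun L => ?_⟩
  have hev : ∀ᶠ n : ℕ in atTop, ∀ w : List A, w.length ≤ 2 * L →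
      (occ (pref (C.shuffler.out x y) (2 * (n + L))) w : ℝ) ≤
        K * (2 * (n + L) : ℕ) / (Fintype.card A : ℝ) ^ w.length := by
    have h1 : Tendsto (fun n : ℕ => 2 * (n + L)) atTop atTop :=
      tendsto_atTop_mono (fun n => by simp only [id_eq]; omega) tendsto_id
    exact h1.eventually (hz.eventually_occ_le (2 * L))
  filter_upwards [hev, eventually_ge_atTop L] with n hn hnL
  set P := (Finset.range n).image (window γ L) with hP
  have hPmem : ∀ p ∈ P, ∃ t, window γ L t = p := fun p hp => by
    obtain ⟨t, _, ht⟩ := Finset.mem_image.1 hp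
    exact ⟨t, ht⟩
  have hlen1 : ∀ t, (c3in1 (fun i => γ (t + i)) L).length ≤ L := fun t =>
    length_readWord_le (fun i => (γ (t + i)).2.1.1) L
  have hlen2 : ∀ t, (c3in2 (fun i => γ (t + i)) L).length ≤ L := fun t =>
    length_readWord_le (fun i => (γ (t + i)).2.1.2) L
  have e1 : ∀ t, ((window γ L t).map fun τ => τ.2.1.1).reduceOption =
      c3in1 (fun i => γ (t + i)) L := fun t => by
    simp only [window, List.map_map, Function.comp_def, c3in1]
  have e2 : ∀ t, ((window γ L t).map fun τ => τ.2.1.2).reduceOption =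
      c3in2 (fun i => γ (t + i)) L := fun t => by
    simp only [window, List.map_map, Function.comp_def, c3in2]
  have eo : ∀ t, ((window γ L t).map fun τ => τ.2.2.1).flatten =
      c3out (fun i => γ (t + i)) L := fun t => by
    simp only [window, List.map_map, Function.comp_def, c3out]
  have ew : ∀ t, ((window γ L t).map labelWord).flatten.length =
      readLength (fun i => γ (t + i)) L := fun t => by
    rw [← length_labelWord_flatten]
    simp only [window, List.map_map, Function.comp_def]
  have hterm : ∀ p ∈ P, (({t ∈ Finset.range n | window γ L t = p} : Finset ℕ).card : ℝ) *
      weight p ≤ E * (4 * K) * n *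
        (((Fintype.card A : ℝ)⁻¹) ^ (p.map fun τ => τ.2.1.2).reduceOption.length *
          ((Fintype.card D : ℝ)⁻¹) ^ (p.map fun τ => τ.2.2.1).flatten.length) := by
    intro p hp
    obtain ⟨t, rfl⟩ := hPmem p hp
    have hw := hn _ ((ew t).le.trans (by
      have := hlen1 t; have := hlen2 t; rw [readLength]; omega))
    have hcard : (({r ∈ Finset.range n | window γ L r = window γ L t} : Finset ℕ).card : ℝ) ≤
        E * occ (pref (C.shuffler.out x y) (2 * (n + L)))
          ((window γ L t).map labelWord).flatten := by
      exact_mod_cast hγ.isRun.card_window_le hC hE L n (window γ L t)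
    rw [ew, readLength] at hw
    rw [weight, e1, e2, eo]
    set a := (c3in1 (fun i => γ (t + i)) L).length
    set b := (c3in2 (fun i => γ (t + i)) L).length
    set o := (c3out (fun i => γ (t + i)) L).length
    have hn4 : ((2 * (n + L) : ℕ) : ℝ) ≤ 4 * n := by
      exact_mod_cast (by omega : 2 * (n + L) ≤ 4 * n)
    calc _ ≤ (E * (K * (4 * n) / (Fintype.card A : ℝ) ^ (a + b))) *
          ((Fintype.card A : ℝ) ^ a * ((Fintype.card D : ℝ)⁻¹) ^ o) := by
          refine mul_le_mul_of_nonneg_right (hcard.trans ?_) (by positivity)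
          refine mul_le_mul_of_nonneg_left (hw.trans ?_) (by positivity)
          gcongr
      _ = _ := by
          rw [pow_add, inv_pow, inv_pow]
          field_simp
  have hsum : ∑ t ∈ Finset.range n, weight (window γ L t) = ∑ p ∈ P,
      (({t ∈ Finset.range n | window γ L t = p} : Finset ℕ).card : ℝ) * weight p := by
    rw [Finset.sum_comp]
    simp only [nsmul_eq_mul, hP]
  rw [hsum]
  refine (Finset.sum_le_sum hterm).trans ?_
  rw [← Finset.mul_sum]
  have hkey := sum_mul_le_of_injOn P _ _ _
    ((hC'.injOn_window hC hγ L).mono fun p hp => hPmem p hp)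
    ((Finset.univ : Finset (Option Q)) ×ˢ (Finset.univ : Finset (Option Q)) ×ˢ
      Finset.range (L + 1))
    (fun p hp => by
      obtain ⟨t, rfl⟩ := hPmem p hp
      simp only [Finset.mem_product, Finset.mem_univ, true_and, Finset.mem_range, e1]
      exact Nat.lt_succ_of_le (hlen1 t))
    (fun b => ((Fintype.card A : ℝ)⁻¹) ^ b.length) (fun o => ((Fintype.card D : ℝ)⁻¹) ^ o.length)
    (fun _ => by positivity) (fun _ => by positivity)
    (c₁ := (L : ℝ) + 1) (c₂ := ((L * M : ℕ) : ℝ) + 1)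
    (fun T hT => sum_inv_card_pow_length_le T fun b hb => by
      obtain ⟨p, hp, rfl⟩ := hT b hb
      obtain ⟨t, rfl⟩ := hPmem p hp
      rw [e2]
      exact hlen2 t)
    (fun T hT => sum_inv_card_pow_length_le T fun b hb => by
      obtain ⟨p, hp, rfl⟩ := hT b hb
      obtain ⟨t, rfl⟩ := hPmem p hp
      rw [eo]
      exact length_c3out_le (hM' t) L)
  refine (mul_le_mul_of_nonneg_left hkey (by positivity)).trans ?_
  simp only [Finset.card_product, Finset.card_univ, Fintype.card_option, Finset.card_range]
  push_cast
  have hLM : (L : ℝ) * M + 1 ≤ (L + 1) * (M + 1) := by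
    nlinarith [L.cast_nonneg (α := ℝ), M.cast_nonneg (α := ℝ)]
  calc _ ≤ E * (4 * K) * n * (((Fintype.card Q : ℝ) + 1) * (((Fintype.card Q : ℝ) + 1) *
        ((L : ℝ) + 1)) * (((L : ℝ) + 1) * ((L + 1) * (M + 1)))) := by gcongr
    _ = _ := by ring

/-! ### Compression ratios of weakly normal pairs -/

lemma tendsto_succ_pow_mul_exp_neg {δ : ℝ} (hδ : 0 < δ) :
    Tendsto (fun L : ℕ => ((L : ℝ) + 1) ^ 3 * Real.exp (-(δ * L))) atTop (𝓝 0) := by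
  have h1 := (tendsto_add_atTop_iff_nat 1).2 (tendsto_pow_const_mul_const_pow_of_abs_lt_one 3
    (r := Real.exp (-δ)) (by rw [abs_of_pos (Real.exp_pos _), Real.exp_lt_one_iff]; linarith))
  have h2 := h1.const_mul (Real.exp δ)
  rw [mul_zero] at h2
  refine h2.congr fun L => ?_
  rw [← Real.exp_nat_mul, mul_left_comm, ← Real.exp_add]
  push_cast
  congr 2
  ring

lemma weight_pos [Fintype A] [Fintype D] (hk : 0 < Fintype.card A) (hd : 0 < Fintype.card D)
    (p : List (Q × (Option A × Option B) × List D × Q)) : 0 < weight p := by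
  rw [weight]
  positivity

/-- The number of symbols saved by the output of a run along its first `n` transitions. -/
noncomputable def saving [Fintype A] [Fintype D]
    (γ : ℕ → Q × (Option A × Option B) × List D × Q) (n : ℕ) : ℝ :=
  (c3in1 γ n).length * Real.log (Fintype.card A) - (c3out γ n).length * Real.log (Fintype.card D)

lemma saving_add [Fintype A] [Fintype D] (hk : 0 < Fintype.card A) (hd : 0 < Fintype.card D)
    (γ : ℕ → Q × (Option A × Option B) × List D × Q) (t L : ℕ) :
    saving γ (t + L) = saving γ t + Real.log (weight (window γ L t)) := by
  have h1 : c3in1 γ (t + L) = c3in1 γ t ++ c3in1 (fun i => γ (t + i)) L :=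
    readWord_add (fun i => (γ i).2.1.1) t L
  have hk' : (0 : ℝ) < Fintype.card A := by exact_mod_cast hk
  have hd' : (0 : ℝ) < Fintype.card D := by exact_mod_cast hd
  rw [saving, saving, weight_window, Real.log_mul (by positivity) (by positivity), Real.log_pow,
    Real.log_pow, Real.log_inv, h1, c3out_add, List.length_append, List.length_append]
  push_cast
  ring

lemma saving_mul_le [Fintype A] [Fintype D] (hk : 0 < Fintype.card A) (hd : 0 < Fintype.card D)
    (γ : ℕ → Q × (Option A × Option B) × List D × Q) (δ : ℝ) (L q : ℕ) :
    saving γ (q * L) ≤ δ * (q * L : ℕ) +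
      Real.exp (-(δ * L)) * ∑ j ∈ Finset.range q, weight (window γ L (j * L)) := by
  induction q with
  | zero => simp [saving, c3in1, c3out]
  | succ q ih =>
    rw [Nat.succ_mul, saving_add hk hd, Finset.sum_range_succ, mul_add]
    have hw := weight_pos hk hd (window γ L (q * L))
    have h1 := Real.log_le_sub_one_of_pos (mul_pos (Real.exp_pos (-(δ * L))) hw)
    rw [Real.log_mul (Real.exp_pos _).ne' hw.ne', Real.log_exp] at h1
    push_cast at ih ⊢
    linarith

lemma saving_le [Fintype A] [Fintype D] (hk : 0 < Fintype.card A) (hd : 0 < Fintype.card D)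
    (γ : ℕ → Q × (Option A × Option B) × List D × Q) {δ : ℝ} (hδ : 0 ≤ δ) {L : ℕ} (hL : 0 < L)
    (n : ℕ) :
    saving γ n ≤ L * Real.log (Fintype.card A) + δ * n +
      Real.exp (-(δ * L)) * ∑ t ∈ Finset.range n, weight (window γ L t) := by
  have hdm : n / L * L + n % L = n := Nat.div_add_mod' n L
  set q := n / L
  have hr : n % L < L := Nat.mod_lt n hL
  have hlogk : 0 ≤ Real.log (Fintype.card A) := Real.log_natCast_nonneg _
  have hlogd : 0 ≤ Real.log (Fintype.card D) := Real.log_natCast_nonneg _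
  have h1 : saving γ n ≤ saving γ (q * L) + L * Real.log (Fintype.card A) := by
    have e1 : c3in1 γ n = c3in1 γ (q * L) ++ c3in1 (fun i => γ (q * L + i)) (n % L) := by
      conv_lhs => rw [← hdm]
      exact readWord_add (fun i => (γ i).2.1.1) _ _
    have e2 : c3out γ n = c3out γ (q * L) ++ c3out (fun i => γ (q * L + i)) (n % L) := by
      conv_lhs => rw [← hdm]
      exact c3out_add γ _ _
    have e3 : ((c3in1 (fun i => γ (q * L + i)) (n % L)).length : ℝ) ≤ L := by
      exact_mod_cast (length_readWord_le (fun i => (γ (q * L + i)).2.1.1) (n % L)).trans hr.le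
    rw [saving, saving, e1, e2, List.length_append, List.length_append]
    push_cast
    have e4 := mul_le_mul_of_nonneg_right e3 hlogk
    have e5 : 0 ≤ ((c3out (fun i => γ (q * L + i)) (n % L)).length : ℝ) *
      Real.log (Fintype.card D) := by positivity
    linarith
  have h2 := saving_mul_le hk hd γ δ L q
  have h3 : ∑ j ∈ Finset.range q, weight (window γ L (j * L)) ≤
      ∑ t ∈ Finset.range n, weight (window γ L t) := by
    rw [← Finset.sum_image (f := fun t => weight (window γ L t)) (g := fun j => j * L)
      fun i _ j _ hij => Nat.eq_of_mul_eq_mul_right hL hij]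
    refine Finset.sum_le_sum_of_subset_of_nonneg ?_ fun t _ _ => (weight_pos hk hd _).le
    intro t ht
    obtain ⟨j, hj, rfl⟩ := Finset.mem_image.1 ht
    have := Nat.mul_le_mul_right L (Finset.mem_range.1 hj)
    rw [Nat.succ_mul] at this
    exact Finset.mem_range.2 (by omega)
  have h4 : ((q * L : ℕ) : ℝ) ≤ n := by exact_mod_cast (by omega : q * L ≤ n)
  have h5 := mul_le_mul_of_nonneg_left h3 (Real.exp_pos (-(δ * L))).le
  have h6 := mul_le_mul_of_nonneg_left h4 hδ
  linarith

namespace Comp3.IsAccRunOn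

variable [Fintype A] {C : Comp3 A A D Q} {γ : ℕ → Q × (Option A × Option A) × List D × Q}
  {x y : ℕ → A}

/-- A compressor saves few symbols on a pair whose shuffles are weakly normal. -/
lemma eventually_saving_le [Fintype D] [Fintype Q] (hA : 0 < Fintype.card A)
    (hD : 0 < Fintype.card D) (hC : C.TwoDet) (hC' : C.OneToOne) (hγ : C.IsAccRunOn γ x y)
    {K : ℝ} (hK : 0 < K) (hz : WeaklyNormal K (C.shuffler.out x y)) {ε : ℝ} (hε : 0 < ε) :
    ∀ᶠ n : ℕ in atTop, saving γ n ≤ ε * n := by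
  have : Nonempty A := Fintype.card_pos_iff.1 hA
  obtain ⟨c, hc, hsum⟩ := hγ.exists_sum_weight_le hC hC' hK hz
  have h1 : Tendsto (fun L : ℕ => c * (((L : ℝ) + 1) ^ 3 * Real.exp (-(ε / 3 * L)))) atTop
      (𝓝 0) := by
    simpa using (tendsto_succ_pow_mul_exp_neg (by positivity : 0 < ε / 3)).const_mul c
  obtain ⟨L, hL, hL0⟩ := ((h1.eventually_lt_const (by positivity : 0 < ε / 3)).and
    (eventually_gt_atTop 0)).exists
  have h2 : ∀ᶠ n : ℕ in atTop, L * Real.log (Fintype.card A) ≤ ε / 3 * n :=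
    (tendsto_natCast_atTop_atTop.const_mul_atTop (by positivity : 0 < ε / 3)).eventually_ge_atTop _
  filter_upwards [hsum L, h2] with n hn hn'
  have h3 := saving_le hA hD γ (by positivity : 0 ≤ ε / 3) hL0 n
  have h4 := mul_le_mul_of_nonneg_left hn (Real.exp_pos (-(ε / 3 * L))).le
  have h5 := mul_le_mul_of_nonneg_right hL.le n.cast_nonneg
  linarith

/-- A run reads its first input at a positive rate. -/
lemma exists_linear_le [Fintype Q] (hA : 2 ≤ Fintype.card A) (hC : C.TwoDet)
    (hγ : C.IsAccRunOn γ x y) {K : ℝ} (hK : 0 < K) (hz : WeaklyNormal K (C.shuffler.out x y)) :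
    ∃ c : ℝ, 0 < c ∧ ∀ᶠ n : ℕ in atTop, c * n ≤ (c3in1 γ n).length := by
  have h := hγ.isRun
  have hcfg : ∀ n, (C.shuffler.cfg x y (readLength γ n)).2.1 = (c3in1 γ n).length := fun n => by
    rw [h.shuffler_cfg hC]
  have hread : Tendsto (readLength γ) atTop atTop :=
    tendsto_atTop_mono (fun n => Nat.le_add_right _ _) h.tendsto1
  have hinf : ∀ n, ∃ m ≥ n, C.shuffler.tyI (C.shuffler.cfg x y m).1 = true := by
    intro n
    by_contra! hcon
    obtain ⟨t, ht⟩ := (h.tendsto1.eventually_gt_atTop n).exists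
    rw [← hcfg, Shuffler.cfg_snd_fst] at ht
    rw [← Finset.card_range n] at ht
    refine ht.not_ge (Finset.card_le_card fun m hm => ?_)
    by_contra hmn
    rw [Finset.mem_range, not_lt] at hmn
    exact hcon m hmn (Finset.mem_filter.1 hm).2
  obtain ⟨c, hc, hlin⟩ := C.shuffler.linear_le_of_weaklyNormal hA x y hz hK hinf
  obtain ⟨E, hE⟩ := h.exists_idle_bound hC
  have hE0 : 0 < E := by
    refine Nat.pos_of_ne_zero fun h0 => ?_
    have := hE 0
    simp [h0] at this
  have hmul : ∀ j, j ≤ readLength γ (j * E) := by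
    intro j
    induction j with
    | zero => exact Nat.zero_le _
    | succ j ih =>
      have := hE (j * E)
      rw [Nat.succ_mul]
      omega
  refine ⟨c / (2 * E), by positivity, ?_⟩
  filter_upwards [hread.eventually hlin, eventually_ge_atTop (2 * E)] with n hn hnE
  rw [hcfg] at hn
  refine le_trans ?_ hn
  have h1 : n / E ≤ readLength γ n :=
    (hmul _).trans (readLength_mono γ (Nat.div_mul_le_self n E))
  have h2 : n < (n / E + 1) * E := Nat.lt_mul_of_div_lt (Nat.lt_succ_self _) hE0
  have h3 : n ≤ 2 * E * readLength γ n := by nlinarith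
  have h4 : (n : ℝ) ≤ 2 * E * readLength γ n := by exact_mod_cast h3
  rw [div_mul_eq_mul_div, div_le_iff₀ (by positivity)]
  nlinarith

/-- A conditional compressor does not compress a pair whose shuffles are weakly normal. -/
lemma one_le_liminf [Fintype D] [Fintype Q] (hA : 2 ≤ Fintype.card A) (hD : 0 < Fintype.card D)
    (hC : C.TwoDet) (hC' : C.OneToOne) (hγ : C.IsAccRunOn γ x y) {K : ℝ} (hK : 0 < K)
    (hz : WeaklyNormal K (C.shuffler.out x y)) :
    1 ≤ liminf (fun n : ℕ => ((c3out γ n).length * Real.log (Fintype.card D)) /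
      ((c3in1 γ n).length * Real.log (Fintype.card A))) atTop := by
  obtain ⟨c, hc, hlin⟩ := hγ.exists_linear_le hA hC hK hz
  obtain ⟨M, hM⟩ := hC.exists_length_le
  have hlogk : 0 < Real.log (Fintype.card A) := Real.log_pos (by exact_mod_cast hA)
  have hlogd : 0 ≤ Real.log (Fintype.card D) := Real.log_natCast_nonneg _
  have hbdd : IsBoundedUnder (· ≤ ·) atTop
      (fun n : ℕ => ((c3out γ n).length * Real.log (Fintype.card D)) /
        ((c3in1 γ n).length * Real.log (Fintype.card A))) := by
    refine isBoundedUnder_of_eventually_le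
      (a := M * Real.log (Fintype.card D) / (c * Real.log (Fintype.card A))) ?_
    filter_upwards [hlin, eventually_gt_atTop 0] with n hn hn0
    have hn0' : (0 : ℝ) < n := by exact_mod_cast hn0
    have h1 : ((c3out γ n).length : ℝ) ≤ n * M := by
      exact_mod_cast length_c3out_le (fun i => hM _ (hγ.2.1 i)) n
    calc _ ≤ (n * M) * Real.log (Fintype.card D) / (c * n * Real.log (Fintype.card A)) := by
          gcongr
      _ = _ := by field_simp
  refine le_of_forall_pos_le_add fun ε hε => sub_le_iff_le_add.1
    (le_liminf_of_le hbdd.isCoboundedUnder_ge ?_)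
  have hε' : 0 < c * (Real.log (Fintype.card A) * ε) := by positivity
  filter_upwards [hlin, eventually_gt_atTop 0,
    hγ.eventually_saving_le (by omega) hD hC hC' hK hz hε'] with n hn hn0 hs
  have hn0' : (0 : ℝ) < n := by exact_mod_cast hn0
  have h1 : 0 < ((c3in1 γ n).length : ℝ) := (by positivity : 0 < c * n).trans_le hn
  rw [le_div_iff₀ (by positivity)]
  rw [saving] at hs
  have h2 : c * n * (Real.log (Fintype.card A) * ε) ≤
      (c3in1 γ n).length * (Real.log (Fintype.card A) * ε) :=
    mul_le_mul_of_nonneg_right hn (by positivity)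
  linarith

end Comp3.IsAccRunOn

/-! ### Compressors as conditional compressors -/

/-- The conditional compressor that compresses its first input as `C` does, and reads its second
input at the same pace. -/
def Comp2.toComp3 (C : Comp2 A D Q) (B : Type*) : Comp3 A B D Q where
  init := C.init
  trans := {τ | (τ.1, τ.2.1.1, τ.2.2) ∈ C.trans ∧ τ.2.1.2.isSome = τ.2.1.1.isSome}

lemma Comp2.OneDet.twoDet_toComp3 {C : Comp2 A D Q} (hC : C.OneDet) : (C.toComp3 B).TwoDet := by
  intro τ h τ' h' hq
  obtain ⟨h1, h2⟩ := hC _ h.1 _ h'.1 hq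
  refine ⟨Prod.ext h1 (by simp only [lsupp]; rw [h.2, h'.2]; exact h1), fun hl => ?_⟩
  have h3 := h2 (congrArg (fun l => l.1) hl)
  exact Prod.ext hq (Prod.ext hl (congrArg (fun r => r.2.2) h3))

/-- A run of `C.toComp3 B` gives a run of `C`. -/
lemma Comp3.IsAccRunOn.toComp2 {C : Comp2 A D Q}
    {γ : ℕ → Q × (Option A × Option B) × List D × Q} {x : ℕ → A} {y : ℕ → B}
    (h : (C.toComp3 B).IsAccRunOn γ x y) :
    C.IsAccRunOn (fun n => ((γ n).1, (γ n).2.1.1, (γ n).2.2)) x :=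
  ⟨h.1, fun n => (h.2.1 n).1, h.2.2.1, h.2.2.2.1, h.2.2.2.2.2.1, h.2.2.2.2.2.2.2⟩

lemma Comp2.OneToOne.toComp3 {C : Comp2 A D Q} (hC : C.OneToOne) : (C.toComp3 B).OneToOne :=
  fun x x' _ _ _ h h' => hC x x' _ _ h.toComp2 h'.toComp2

/-- The labels of the second input in the run of `C.toComp3 B` extending a run of `C`. -/
def secondLabel (l : ℕ → Option A) (y : ℕ → B) (n : ℕ) : Option B :=
  (l n).map fun _ => y (readWord l n).length

lemma length_readWord_secondLabel (l : ℕ → Option A) (y : ℕ → B) (n : ℕ) :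
    (readWord (secondLabel l y) n).length = (readWord l n).length := by
  induction n with
  | zero => rfl
  | succ n ih =>
    rw [readWord_succ, readWord_succ, List.length_append, List.length_append, ih, secondLabel]
    cases l n <;> rfl

lemma reads_secondLabel (l : ℕ → Option A) (y : ℕ → B) : Reads (secondLabel l y) y := by
  intro n b hb
  rw [length_readWord_secondLabel]
  obtain ⟨_, _, rfl⟩ := Option.map_eq_some_iff.1 hb
  rfl

/-- A run of `C` extends to a run of `C.toComp3 B`. -/
lemma Comp2.IsAccRunOn.exists_toComp3 {C : Comp2 A D Q} {γ : ℕ → Q × Option A × List D × Q}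
    {x : ℕ → A} (h : C.IsAccRunOn γ x) (y : ℕ → B) :
    ∃ γ', (C.toComp3 B).IsAccRunOn γ' x y ∧ c3in1 γ' = c2in γ ∧ c3out γ' = c2out γ := by
  refine ⟨fun n => ((γ n).1, ((γ n).2.1, secondLabel (fun i => (γ i).2.1) y n), (γ n).2.2), ?_,
    rfl, rfl⟩
  refine ⟨h.1, fun n => ⟨h.2.1 n, by simp [secondLabel]⟩, h.2.2.1, h.2.2.2.1,
    forall_readWord_eq_pref_iff.2 (reads_secondLabel _ y), h.2.2.2.2.1, ?_, h.2.2.2.2.2⟩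
  exact h.2.2.2.2.1.congr fun n =>
    (length_readWord_secondLabel (fun i => (γ i).2.1) y n).symm

/-- The compressor copying its input. -/
def copier (e : A → D) : Comp2 A D (Fin 1) where
  init := 0
  trans := Set.range fun a => (0, some a, [e a], 0)

lemma copier_oneDet (e : A → D) : (copier e).OneDet := by
  rintro _ ⟨a, rfl⟩ _ ⟨b, rfl⟩ _
  refine ⟨rfl, fun h => ?_⟩
  obtain rfl := Option.some_injective _ h
  rfl

/-- The runs of the compressor copying its input. -/
lemma copier_run {e : A → D} {γ : ℕ → Fin 1 × Option A × List D × Fin 1} {x : ℕ → A}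
    (h : (copier e).IsAccRunOn γ x) (n : ℕ) :
    c2in γ n = pref x n ∧ c2out γ n = (pref x n).map e := by
  choose a ha using h.2.1
  have h12 : c2in γ n = pref a n ∧ c2out γ n = (pref a n).map e := by
    induction n with
    | zero => exact ⟨rfl, rfl⟩
    | succ n ih =>
      have h1 : c2in γ (n + 1) = c2in γ n ++ (γ n).2.1.toList :=
        readWord_succ (fun i => (γ i).2.1) n
      have h2 : c2out γ (n + 1) = c2out γ n ++ (γ n).2.2.1 := by
        simp [c2out, List.range_succ]
      rw [h1, h2, ih.1, ih.2, ← ha]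
      simp [pref, List.range_succ]
  have h3 := h.2.2.2.1 n
  rw [h12.1, length_pref] at h3
  rw [h12.1, h12.2, h3]
  exact ⟨rfl, rfl⟩

lemma copier_oneToOne {e : A → D} (he : e.Injective) : (copier e).OneToOne := by
  intro x x' γ γ' h h' hp _
  funext n
  obtain ⟨m, hm⟩ := hp (n + 1)
  rw [(copier_run h _).2, (copier_run h' _).2] at hm
  have h1 := hm.getElem (i := n) (by simp)
  simp only [pref, List.getElem_map, List.getElem_range] at h1
  exact he h1

lemma copier_isAccRunOn (e : A → D) (x : ℕ → A) :
    (copier e).IsAccRunOn (fun n => (0, some (x n), [e (x n)], 0)) x := by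
  have h1 : ∀ n, c2in (fun n => ((0 : Fin 1), some (x n), [e (x n)], (0 : Fin 1))) n =
      pref x n := by
    intro n
    induction n with
    | zero => rfl
    | succ n ih =>
      simp only [c2in, pref, List.range_succ, List.map_append, List.reduceOption_append] at ih ⊢
      rw [ih]
      rfl
  have h2 : ∀ n, (c2out (fun n => ((0 : Fin 1), some (x n), [e (x n)], (0 : Fin 1))) n).length =
      n := fun n => by simp [c2out, List.length_flatten, Function.comp_def]
  refine ⟨rfl, fun n => ⟨x n, rfl⟩, fun _ => rfl, fun n => ?_, ?_, ?_⟩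
  · rw [h1, length_pref]
  · simp only [h1, length_pref]
    exact tendsto_id
  · simp only [h2]
    exact tendsto_id

/-! ### Independence -/

/-- An infinite word whose shuffles with another one are weakly normal is not compressed, even
conditionally on the other one. -/
lemma rho_eq_one [Fintype A] (hA : 2 ≤ Fintype.card A) {x y : ℕ → A} {K : ℝ} (hK : 0 < K)
    (hz : ∀ T : Shuffler A, WeaklyNormal K (T.out x y)) : rho x = 1 ∧ condRho x y = 1 := by
  have hlogk : 0 < Real.log (Fintype.card A) := Real.log_pos (by exact_mod_cast hA)
  have hcond : ∀ (m d : ℕ), 2 ≤ d → ∀ C : Comp3 A A (Fin d) (Fin m), C.TwoDet → C.OneToOne →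
      ∀ γ, C.IsAccRunOn γ x y → 1 ≤ liminf (fun n : ℕ => ((c3out γ n).length * Real.log d) /
        ((c3in1 γ n).length * Real.log (Fintype.card A))) atTop := by
    intro m d hd C hC hC' γ hγ
    have h1 := hγ.one_le_liminf hA (by rw [Fintype.card_fin]; omega) hC hC' hK (hz _)
    rwa [Fintype.card_fin] at h1
  have hlim : liminf (fun n : ℕ => ((pref x n).length * Real.log (Fintype.card A)) /
      ((pref x n).length * Real.log (Fintype.card A))) atTop = 1 := by
    refine Tendsto.liminf_eq (tendsto_const_nhds.congr' ?_)
    filter_upwards [eventually_gt_atTop 0] with n hn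
    rw [length_pref, div_self]
    positivity
  have he := (Fintype.equivFin A).injective
  obtain ⟨γ₀, hrun⟩ : ∃ γ, (copier (Fintype.equivFin A)).IsAccRunOn γ x :=
    ⟨_, copier_isAccRunOn _ x⟩
  have hinout := copier_run hrun
  obtain ⟨γ₁, hrun₁, hin₁, hout₁⟩ := hrun.exists_toComp3 y
  constructor
  · refine IsLeast.csInf_eq ⟨⟨1, Fintype.card A, hA, copier _, copier_oneDet _,
      copier_oneToOne he, _, hrun, ?_⟩, ?_⟩
    · simp only [hinout, List.length_map]
      exact hlim.symm
    · rintro _ ⟨m, d, hd, C, hC, hC', γ, hγ, rfl⟩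
      obtain ⟨γ', hγ', hin', hout'⟩ := hγ.exists_toComp3 y
      rw [← hin', ← hout']
      exact hcond m d hd _ hC.twoDet_toComp3 hC'.toComp3 γ' hγ'
  · refine IsLeast.csInf_eq ⟨⟨1, Fintype.card A, hA, (copier _).toComp3 A,
      (copier_oneDet _).twoDet_toComp3, (copier_oneToOne he).toComp3, _, hrun₁, ?_⟩, ?_⟩
    · simp only [hin₁, hout₁, hinout, List.length_map]
      exact hlim.symm
    · rintro _ ⟨m, d, hd, C, hC, hC', γ, hγ, rfl⟩
      exact hcond m d hd C hC hC' γ hγ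

lemma normal_fsIndep_of_weaklyNormal [Fintype A] (hA : 2 ≤ Fintype.card A) {x y : ℕ → A} {K : ℝ}
    (hK : 0 < K) (hz : ∀ T : Shuffler A, WeaklyNormal K (T.out x y)) :
    Normal x ∧ Normal y ∧ FSIndep x y := by
  obtain ⟨h1, h2⟩ := rho_eq_one hA hK hz
  obtain ⟨h3, h4⟩ := rho_eq_one hA hK fun T => by
    have := hz T.swap
    rwa [Shuffler.out_swap] at this
  have h5 := hz (Shuffler.fst A)
  have h6 := hz (Shuffler.snd A)
  rw [Shuffler.out_fst] at h5
  rw [Shuffler.out_snd] at h6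
  refine ⟨h5.normal hA, h6.normal hA, ?_⟩
  rw [FSIndep, h1, h2, h3, h4]
  exact ⟨rfl, rfl, one_pos, one_pos⟩

/-- Every pair of infinite words in `⋂_{n ≥ 0} G_n` is a pair of
normal, finite-state independent words. Here `(S_i)` is an enumeration of the
shufflers over `A` (up to input-output equivalence, with indices starting at `1`). -/
theorem Gn_inter_normal_fsIndep {A : Type*} [Fintype A] (hA : 2 ≤ Fintype.card A)
    (S : ℕ → Shuffler A)
    (henum : ∀ T : Shuffler A, ∃ i, 1 ≤ i ∧ ∀ x y : ℕ → A, (S i).out x y = T.out x y)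
    (u v : ℕ → A) (huv : ∀ n : ℕ, (u, v) ∈ Gn S n) :
    Normal u ∧ Normal v ∧ FSIndep u v := by
  have hK : (0 : ℝ) < 2 * Fintype.card A := by
    have : 0 < Fintype.card A := by omega
    positivity
  exact normal_fsIndep_of_weaklyNormal hA hK (weaklyNormal_out hA S henum u v huv)

end FSI
end
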